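/- arXiv:0808.1273 — 5 statements merged into one kernel-verified Lean document; each statement's English description precedes it below -/
import Mathlib

section
/- Let S = ℤ² ∖ {(1,1), (−1,−1)} and define φ : S → M₂(ℂ) by: φ(0,0) = the identity matrix, φ(1,0) = the matrix with 1 in the (2,1) entry and 0 elsewhere, φ(0,1) = the matrix with 1 in the (1,2) entry and 0 elsewhere, φ(−1,0) = φ(1,0)*, φ(0,−1) = φ(0,1)*, and φ(g) = 0 for all other g ∈ S. Then φ is positive definite on S. -/
set_option linter.unusedVariables false

open scoped ComplexOrder Pointwise InnerProductSpace BoundedContinuousFunction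

/-- The set `S = ℤ² ∖ {(1,1), (−1,−1)}`. -/
def Sphi : Set (ℤ × ℤ) := {((1 : ℤ), (1 : ℤ)), ((-1 : ℤ), (-1 : ℤ))}ᶜ

/-- The function `φ : S → M₂(ℂ)`: identity at `0`, the elementary matrix `E₂₁` at `(1,0)`,
`E₁₂` at `(0,1)`, their adjoints at the inverses, `0` elsewhere. -/
noncomputable def phiFn : ℤ × ℤ → Matrix (Fin 2) (Fin 2) ℂ := fun g =>
  if g = (0, 0) then 1
  else if g = (1, 0) then Matrix.of ![![0, 0], ![1, 0]]
  else if g = (0, 1) then Matrix.of ![![0, 1], ![0, 0]]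
  else if g = (-1, 0) then Matrix.conjTranspose (Matrix.of ![![0, 0], ![1, 0]])
  else if g = (0, -1) then Matrix.conjTranspose (Matrix.of ![![0, 1], ![0, 0]])
  else 0

/-- The relation `(u, a) ∼ (v, b)` on `ℤ² × {0, 1}`, in terms of `d = v - u`, describing the
nonzero entries of `φ`. -/
def PhiRel (d : ℤ × ℤ) (a b : Fin 2) : Prop :=
  (d.1 = 0 ∧ d.2 = 0 ∧ a = b) ∨ (d.1 = 1 ∧ d.2 = 0 ∧ a = 1 ∧ b = 0) ∨
    (d.1 = 0 ∧ d.2 = 1 ∧ a = 0 ∧ b = 1) ∨ (d.1 = -1 ∧ d.2 = 0 ∧ a = 0 ∧ b = 1) ∨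
    (d.1 = 0 ∧ d.2 = -1 ∧ a = 1 ∧ b = 0)

open Classical in
theorem phiFn_apply (d : ℤ × ℤ) (a b : Fin 2) :
    phiFn d a b = if PhiRel d a b then 1 else 0 := by
  obtain ⟨x, y⟩ := d
  unfold phiFn
  split_ifs <;> fin_cases a <;> fin_cases b <;> simp_all [PhiRel] <;> omega

theorem mem_Sphi_iff (d : ℤ × ℤ) :
    d ∈ Sphi ↔ ¬ (d.1 = 1 ∧ d.2 = 1) ∧ ¬ (d.1 = -1 ∧ d.2 = -1) := by
  simp [Sphi, Prod.ext_iff]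

theorem phiRel_equivalence {ι : Type*} (g : ι → ℤ × ℤ) (hg : ∀ i j, g j - g i ∈ Sphi) :
    Equivalence fun p q : ι × Fin 2 => PhiRel (g q.1 - g p.1) p.2 q.2 where
  refl p := by simp [PhiRel]
  symm {p q} h := by
    simp only [PhiRel, Prod.fst_sub, Prod.snd_sub] at h ⊢
    rcases h with h | h | h | h | h <;> omega
  trans {p q r} h₁ h₂ := by
    have h := (mem_Sphi_iff _).1 (hg p.1 r.1)
    simp only [PhiRel, Prod.fst_sub, Prod.snd_sub] at h h₁ h₂ ⊢
    rcases h₁ with h₁ | h₁ | h₁ | h₁ | h₁ <;> rcases h₂ with h₂ | h₂ | h₂ | h₂ | h₂ <;> omega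

/-- The indicator matrix of an equivalence relation is positive semidefinite. -/
theorem Setoid.posSemidef_indicator {α : Type*} [Finite α] (s : Setoid α)
    [DecidableRel fun a b : α => s a b] :
    (Matrix.of fun a b : α => if s a b then (1 : ℂ) else 0).PosSemidef := by
  classical
  have h := (Matrix.PosSemidef.one (n := Quotient s) (R := ℂ)).submatrix (Quotient.mk s)
  convert h using 1
  ext a b
  simp only [Matrix.of_apply, Matrix.submatrix_apply, Matrix.one_apply, Quotient.eq]

/-- `φ` is positive definite on `S = ℤ² ∖ {(1,1), (−1,−1)}`: for any `g₁,…,gₙ` with all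
differences in `S`, the block matrix `(φ(gⱼ − gᵢ))` is positive semidefinite. -/
theorem phiFn_posDef :
    ∀ (n : ℕ) (g : Fin n → ℤ × ℤ), (∀ i j, g j - g i ∈ Sphi) →
      (Matrix.of fun p q : Fin n × Fin 2 => phiFn (g q.1 - g p.1) p.2 q.2).PosSemidef := by
  classical
  intro n g hg
  simp only [phiFn_apply]
  exact Setoid.posSemidef_indicator ⟨_, phiRel_equivalence g hg⟩
end

section
/- Let m, n ≥ 2 be integers and let S = {(k,0) : |k| ≤ m} ∪ {(0,l) : |l| ≤ n} ⊆ ℤ². Every positive definite function c : S → ℂ admits a positive definite extension to ℤ², i.e. there is a positive definite C : ℤ² → ℂ with C(s) = c(s) for all s ∈ S. -/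
set_option linter.unusedVariables false

open scoped ComplexOrder Pointwise InnerProductSpace BoundedContinuousFunction

/-- A complex sequence on `ℤ²` is positive definite. -/
def IsPosDefSeq (C : ℤ × ℤ → ℂ) : Prop :=
  ∀ (n : ℕ) (g : Fin n → ℤ × ℤ),
    (Matrix.of fun i j : Fin n => C (g j - g i)).PosSemidef

/-- A complex sequence is (partially) positive definite on `S`;
only the values on `S` are involved. -/
def IsPosDefSeqOn (S : Set (ℤ × ℤ)) (c : ℤ × ℤ → ℂ) : Prop :=
  ∀ (n : ℕ) (g : Fin n → ℤ × ℤ), (∀ i j, g j - g i ∈ S) →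
    (Matrix.of fun i j : Fin n => c (g j - g i)).PosSemidef

/-- A positive semidefinite matrix is the Gram matrix of vectors in a Euclidean space. -/
lemma Matrix.PosSemidef.exists_eq_inner {ι : Type*} [Fintype ι] {A : Matrix ι ι ℂ}
    (hA : A.PosSemidef) :
    ∃ v : ι → EuclideanSpace ℂ ι, ∀ i j, A i j = ⟪v i, v j⟫_ℂ := by
  classical
  open scoped MatrixOrder in
  obtain ⟨B, hB⟩ := CStarAlgebra.nonneg_iff_eq_star_mul_self.mp hA.nonneg
  refine ⟨fun i ↦ WithLp.toLp 2 fun k ↦ B k i, fun i j ↦ ?_⟩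
  rw [hB, Matrix.star_eq_conjTranspose, Matrix.mul_apply]
  simp [PiLp.inner_apply, mul_comm]

/-- Two families with the same Gram matrix in a finite-dimensional inner product space are
related by a unitary. -/
lemma exists_linearIsometryEquiv_of_inner_eq {ι E : Type*} [Fintype ι] [NormedAddCommGroup E]
    [InnerProductSpace ℂ E] [FiniteDimensional ℂ E] (v w : ι → E)
    (h : ∀ i j, ⟪v i, v j⟫_ℂ = ⟪w i, w j⟫_ℂ) :
    ∃ U : E ≃ₗᵢ[ℂ] E, ∀ i, U (v i) = w i := by
  classical
  let T := Fintype.linearCombination ℂ v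
  let T' := Fintype.linearCombination ℂ w
  have hnorm (x : ι → ℂ) : ‖T' x‖ = ‖T x‖ := by
    have hinner : ⟪T' x, T' x⟫_ℂ = ⟪T x, T x⟫_ℂ := by
      simp only [T, T', Fintype.linearCombination_apply, sum_inner, inner_sum, inner_smul_left,
        inner_smul_right, h]
    rw [@norm_eq_sqrt_re_inner ℂ, @norm_eq_sqrt_re_inner ℂ, hinner]
  obtain ⟨s, hs⟩ := T.rangeRestrict.exists_rightInverse_of_surjective T.range_rangeRestrict
  have hs' (y : LinearMap.range T) : T (s y) = y :=
    congrArg Subtype.val (LinearMap.congr_fun hs y)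
  let L : LinearMap.range T →ₗᵢ[ℂ] E :=
    { T' ∘ₗ s with norm_map' := fun y ↦ by simp [hnorm, hs'] }
  refine ⟨L.extend.toLinearIsometryEquiv rfl, fun i ↦ ?_⟩
  have hTv : T (Pi.single i 1) = v i := by simp [T]
  have hTw : T' (Pi.single i 1) = w i := by simp [T']
  let y : LinearMap.range T := ⟨v i, Pi.single i 1, hTv⟩
  have hdiff : T' (s y - Pi.single i 1) = 0 := by
    rw [← norm_eq_zero, hnorm, map_sub, hs', hTv, sub_self, norm_zero]
  have hext : L.extend (v i) = T' (s y) := L.extend_apply y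
  rw [LinearIsometry.toLinearIsometryEquiv_apply, hext, ← sub_eq_zero, ← hTw, ← map_sub, hdiff]

/-- A scalar positive semidefinite Toeplitz matrix of size `N + 1` has entries `⟪x, U ^ k x⟫`
for some unitary `U`. -/
lemma exists_unitary_of_toeplitz_posSemidef (N : ℕ) (a : ℤ → ℂ)
    (ha : (Matrix.of fun i j : Fin (N + 1) => a ((j : ℤ) - i)).PosSemidef) :
    ∃ (U : EuclideanSpace ℂ (Fin (N + 1)) ≃ₗᵢ[ℂ] EuclideanSpace ℂ (Fin (N + 1)))
      (x : EuclideanSpace ℂ (Fin (N + 1))), ∀ k : ℤ, |k| ≤ N → a k = ⟪x, (U ^ k) x⟫_ℂ := by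
  obtain ⟨v, hv⟩ := ha.exists_eq_inner
  simp only [Matrix.of_apply] at hv
  obtain ⟨U, hU⟩ := exists_linearIsometryEquiv_of_inner_eq
    (fun i : Fin N ↦ v i.castSucc) (fun i ↦ v i.succ) fun i j ↦ by
      rw [← hv, ← hv]; simp
  have hpow (k : ℕ) (hk : k < N + 1) : (U ^ k) (v 0) = v ⟨k, hk⟩ := by
    induction k with
    | zero => rfl
    | succ k ih =>
      rw [pow_succ', LinearIsometryEquiv.coe_mul, Function.comp_apply, ih (by omega)]
      exact hU ⟨k, by omega⟩
  refine ⟨U, v 0, fun k hk ↦ ?_⟩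
  obtain ⟨n, rfl | rfl⟩ := k.eq_nat_or_neg
  · have hn : n < N + 1 := by simp at hk; omega
    rw [zpow_natCast, hpow n hn, ← hv]
    simp
  · have hn : n < N + 1 := by simp at hk; omega
    rw [← LinearIsometryEquiv.inner_map_map (U ^ n), hpow n hn, zpow_neg, zpow_natCast,
      LinearIsometryEquiv.coe_inv, LinearIsometryEquiv.apply_symm_apply, ← hv]
    simp

/-- Matrix coefficients of a unitary representation of `ℤ` are positive definite. -/
lemma posSemidef_inner_zpow {ι E : Type*} [Finite ι] [NormedAddCommGroup E]
    [InnerProductSpace ℂ E] (U : E ≃ₗᵢ[ℂ] E) (x : E) (g : ι → ℤ) :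
    (Matrix.of fun i j => ⟪x, (U ^ (g j - g i)) x⟫_ℂ).PosSemidef := by
  have hgram : (Matrix.of fun i j => ⟪x, (U ^ (g j - g i)) x⟫_ℂ) =
      Matrix.gram ℂ fun i ↦ (U ^ g i) x := by
    ext i j
    rw [Matrix.of_apply, Matrix.gram_apply, ← LinearIsometryEquiv.inner_map_map (U ^ g i),
      ← Function.comp_apply (f := ⇑(U ^ g i)), ← LinearIsometryEquiv.coe_mul, ← zpow_add,
      add_sub_cancel]
  rw [hgram]
  exact Matrix.posSemidef_gram ℂ _

/-- For `S = {(k,0) : |k| ≤ m} ∪ {(0,l) : |l| ≤ n}` with `m, n ≥ 2`, every positive definite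
scalar function on `S` extends to a positive definite function on `ℤ²`. -/
theorem cross_scalar_extension (m n : ℤ) (hm : 2 ≤ m) (hn : 2 ≤ n)
    (c : ℤ × ℤ → ℂ)
    (hc : IsPosDefSeqOn {p : ℤ × ℤ | (p.2 = 0 ∧ |p.1| ≤ m) ∨ (p.1 = 0 ∧ |p.2| ≤ n)} c) :
    ∃ C : ℤ × ℤ → ℂ, IsPosDefSeq C ∧
      ∀ s ∈ {p : ℤ × ℤ | (p.2 = 0 ∧ |p.1| ≤ m) ∨ (p.1 = 0 ∧ |p.2| ≤ n)}, C s = c s := by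
  lift m to ℕ using by omega
  lift n to ℕ using by omega
  obtain ⟨U, x, hU⟩ := exists_unitary_of_toeplitz_posSemidef m (fun k ↦ c (k, 0)) <| by
    simpa using hc (m + 1) (fun i ↦ ((i : ℤ), 0)) fun i j ↦
      Or.inl ⟨by simp, by simp only [Prod.fst_sub]; rw [abs_le]; omega⟩
  obtain ⟨V, y, hV⟩ := exists_unitary_of_toeplitz_posSemidef n (fun k ↦ c (0, k)) <| by
    simpa using hc (n + 1) (fun i ↦ (0, (i : ℤ))) fun i j ↦
      Or.inr ⟨by simp, by simp only [Prod.snd_sub]; rw [abs_le]; omega⟩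
  have hx : c (0, 0) = ⟪x, x⟫_ℂ := by simpa using hU 0 (by simp)
  have hy : c (0, 0) = ⟪y, y⟫_ℂ := by simpa using hV 0 (by simp)
  refine ⟨fun p ↦ (c (0, 0))⁻¹ * (⟪x, (U ^ p.1) x⟫_ℂ * ⟪y, (V ^ p.2) y⟫_ℂ), fun k g ↦ ?_, ?_⟩
  · have hr : 0 ≤ (c (0, 0))⁻¹ := by
      rw [hx, inner_self_eq_norm_sq_to_K]
      norm_cast
      positivity
    exact ((posSemidef_inner_zpow U x fun i ↦ (g i).1).hadamard
      (posSemidef_inner_zpow V y fun i ↦ (g i).2)).smul hr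
  · by_cases h0 : c (0, 0) = 0
    · have hx0 : x = 0 := inner_self_eq_zero.mp (hx.symm.trans h0)
      have hy0 : y = 0 := inner_self_eq_zero.mp (hy.symm.trans h0)
      rintro ⟨k, l⟩ (⟨rfl, hk⟩ | ⟨rfl, hl⟩)
      · simpa [hx0] using (hU k hk).symm
      · simpa [hy0] using (hV l hl).symm
    · rintro ⟨k, l⟩ (⟨rfl, hk⟩ | ⟨rfl, hl⟩)
      · simp only [zpow_zero, LinearIsometryEquiv.coe_one, id_eq, ← hy, ← hU k hk]
        field_simp
      · simp only [zpow_zero, LinearIsometryEquiv.coe_one, id_eq, ← hx, ← hV l hl]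
        field_simp
end

section
/- Let m, n ≥ 2 be integers, S = {(k,0) : |k| ≤ m} ∪ {(0,l) : |l| ≤ n} ⊆ ℤ², and let U₁, U₂ be unitary operators on a complex Hilbert space H with U₁U₂ ≠ U₂U₁. Define C : S → B(H) by C(k,0) = U₁^k for |k| ≤ m and C(0,l) = U₂^l for |l| ≤ n (so C(0,0) = I). Then C is positive definite on S, but C admits no positive definite extension to ℤ². -/
set_option linter.unusedVariables false

open scoped ComplexOrder Pointwise InnerProductSpace BoundedContinuousFunction

/-- An operator-valued function on an additive group is positive definite. -/
def IsAddPosDefFn {G : Type*} [AddGroup G] {H : Type*} [NormedAddCommGroup H]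
    [InnerProductSpace ℂ H] (Φ : G → H →L[ℂ] H) : Prop :=
  ∀ (n : ℕ) (g : Fin n → G) (ξ : Fin n → H),
    0 ≤ ∑ i, ∑ j, ⟪ξ i, Φ (g j - g i) (ξ j)⟫_ℂ

/-- An operator-valued function on an additive group is (partially) positive definite
on a subset `S`; only the values of `φ` on `S` are involved. -/
def IsAddPosDefFnOn {G : Type*} [AddGroup G] {H : Type*} [NormedAddCommGroup H]
    [InnerProductSpace ℂ H] (S : Set G) (φ : G → H →L[ℂ] H) : Prop :=
  ∀ (n : ℕ) (g : Fin n → G), (∀ i j, g j - g i ∈ S) →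
    ∀ ξ : Fin n → H, 0 ≤ ∑ i, ∑ j, ⟪ξ i, φ (g j - g i) (ξ j)⟫_ℂ

/-- If `t A + conj t B + |t|² c ≥ 0` for all complex `t`, then the linear part vanishes. -/
theorem Complex.eq_zero_of_forall_nonneg {A B c : ℂ}
    (h : ∀ t : ℂ, 0 ≤ t * A + (starRingEnd ℂ) t * B + (starRingEnd ℂ) t * t * c) : A = 0 := by
  have key : ∀ x y : ℝ, (∀ t : ℝ, 0 ≤ t * x + t * t * y) → x = 0 := by
    intro x y hxy
    have h0 : discrim y x 0 ≤ 0 := discrim_le_zero fun t => by linarith [hxy t]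
    rw [discrim] at h0
    nlinarith [sq_nonneg x]
  have hreal : ∀ t : ℝ, 0 ≤ t * (A.re + B.re) + t * t * c.re := fun t => by
    have := (Complex.nonneg_iff.1 (h t)).1
    simp at this
    linarith
  have himag : ∀ t : ℝ, 0 ≤ t * (B.im - A.im) + t * t * c.re := fun t => by
    have := (Complex.nonneg_iff.1 (h (t * Complex.I))).1
    simp at this
    linarith
  have e1 := (Complex.nonneg_iff.1 (h 1)).2
  have e2 := (Complex.nonneg_iff.1 (h (-1))).2
  have e3 := (Complex.nonneg_iff.1 (h Complex.I)).2
  have e4 := (Complex.nonneg_iff.1 (h (-Complex.I))).2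
  simp at e1 e2 e3 e4
  have k1 := key _ _ hreal
  have k2 := key _ _ himag
  apply Complex.ext <;> simp <;> linarith

/-- A positive definite function with `Φ 0 = 1` is multiplicative at every point where its value
is unitary. -/
theorem IsAddPosDefFn.map_add_of_unitary {G : Type*} [AddCommGroup G] {H : Type*}
    [NormedAddCommGroup H] [InnerProductSpace ℂ H] [CompleteSpace H] {Φ : G → H →L[ℂ] H}
    (hΦ : IsAddPosDefFn Φ) (h0 : Φ 0 = 1) {a : G} {V : unitary (H →L[ℂ] H)}
    (ha : Φ a = V) (ha' : Φ (-a) = star (V : H →L[ℂ] H)) (b : G) :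
    Φ (a + b) = (V : H →L[ℂ] H) * Φ b := by
  have hVV : star (V : H →L[ℂ] H) * V = 1 := Unitary.star_mul_self_of_mem V.2
  have hVV' : (V : H →L[ℂ] H) * star (V : H →L[ℂ] H) = 1 := Unitary.mul_star_self_of_mem V.2
  have hV : ∀ x : H, star (V : H →L[ℂ] H) ((V : H →L[ℂ] H) x) = x := fun x =>
    congrArg (fun T : H →L[ℂ] H => T x) hVV
  suffices h : Φ b = star (V : H →L[ℂ] H) * Φ (a + b) by
    rw [h, ← mul_assoc, hVV', one_mul]
  ext η
  refine ext_inner_left ℂ fun ζ => ?_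
  rw [← sub_eq_zero]
  refine Complex.eq_zero_of_forall_nonneg
    (B := ⟪η, Φ (-b) ζ⟫_ℂ - ⟪η, Φ (-(a + b)) ((V : H →L[ℂ] H) ζ)⟫_ℂ) (c := ⟪η, η⟫_ℂ) fun t => ?_
  have h := hΦ 3 ![0, a, a + b] ![-((V : H →L[ℂ] H) ζ), ζ, t • η]
  have hadj : ⟪(V : H →L[ℂ] H) ζ, Φ (a + b) η⟫_ℂ
      = ⟪ζ, (star (V : H →L[ℂ] H) * Φ (a + b)) η⟫_ℂ := by
    rw [ContinuousLinearMap.star_eq_adjoint, mul_apply_eq_comp,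
      ContinuousLinearMap.adjoint_inner_right]
  have hnorm : ⟪(V : H →L[ℂ] H) ζ, (V : H →L[ℂ] H) ζ⟫_ℂ = ⟪ζ, ζ⟫_ℂ := by
    rw [← ContinuousLinearMap.adjoint_inner_right, ← ContinuousLinearMap.star_eq_adjoint, hV]
  have hsub : a - (a + b) = -b := by abel
  simp only [Fin.sum_univ_three, Matrix.cons_val_zero, Matrix.cons_val_one, Matrix.cons_val,
    sub_self, sub_zero, neg_zero, zero_sub, add_sub_cancel_left, hsub, h0, ha, ha', map_neg,
    map_smul, inner_neg_left, inner_neg_right, inner_smul_left, inner_smul_right, hV, hadj, hnorm,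
    one_apply_eq_self, neg_neg] at h
  convert h using 1
  ring

/-- The powers of a unitary operator form a positive definite function. -/
theorem unitary.sum_inner_zpow_sub_nonneg {H : Type*} [NormedAddCommGroup H]
    [InnerProductSpace ℂ H] [CompleteSpace H] (U : unitary (H →L[ℂ] H)) {ι : Type*} [Fintype ι]
    (k : ι → ℤ) (ξ : ι → H) :
    0 ≤ ∑ i, ∑ j, ⟪ξ i, ((U ^ (k j - k i) : unitary (H →L[ℂ] H)) : H →L[ℂ] H) (ξ j)⟫_ℂ := by
  have h : ∀ i j, ⟪ξ i, ((U ^ (k j - k i) : unitary (H →L[ℂ] H)) : H →L[ℂ] H) (ξ j)⟫_ℂ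
      = ⟪((U ^ k i : unitary (H →L[ℂ] H)) : H →L[ℂ] H) (ξ i),
          ((U ^ k j : unitary (H →L[ℂ] H)) : H →L[ℂ] H) (ξ j)⟫_ℂ := by
    intro i j
    rw [← ContinuousLinearMap.adjoint_inner_right, ← ContinuousLinearMap.star_eq_adjoint,
      ← Unitary.coe_star, ← mul_apply_eq_comp, ← Submonoid.coe_mul,
      Unitary.star_eq_inv, ← zpow_neg, ← zpow_add, neg_add_eq_sub]
  simp only [h, ← inner_sum, ← sum_inner]
  rw [inner_self_eq_norm_sq_to_K]
  norm_cast
  exact Complex.zero_le_real.2 (sq_nonneg _)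

/-- If any two points of a family in a product share a coordinate, then all of them share the
same one. -/
theorem forall_snd_eq_or_forall_fst_eq {α β ι : Type*} {g : ι → α × β}
    (hg : ∀ i j, (g j).2 = (g i).2 ∨ (g j).1 = (g i).1) :
    (∀ i j, (g j).2 = (g i).2) ∨ (∀ i j, (g j).1 = (g i).1) := by
  by_contra! ⟨⟨i, j, hij⟩, k, l, hkl⟩
  grind

/-- For `S = {(k,0) : |k| ≤ m} ∪ {(0,l) : |l| ≤ n}` with `m, n ≥ 2` and noncommuting unitaries
`U₁, U₂`, the function `C(k,0) = U₁^k`, `C(0,l) = U₂^l` is positive definite on `S` but admits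
no positive definite extension to `ℤ²`. -/
theorem cross_operator_no_extension
    {H : Type*} [NormedAddCommGroup H] [InnerProductSpace ℂ H] [CompleteSpace H]
    (m n : ℤ) (hm : 2 ≤ m) (hn : 2 ≤ n)
    (U₁ U₂ : unitary (H →L[ℂ] H))
    (hU : (U₁ : H →L[ℂ] H) * (U₂ : H →L[ℂ] H) ≠ (U₂ : H →L[ℂ] H) * (U₁ : H →L[ℂ] H))
    (C : ℤ × ℤ → H →L[ℂ] H)
    (hC1 : ∀ k : ℤ, |k| ≤ m → C (k, 0) = ((U₁ ^ k : unitary (H →L[ℂ] H)) : H →L[ℂ] H))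
    (hC2 : ∀ l : ℤ, |l| ≤ n → C (0, l) = ((U₂ ^ l : unitary (H →L[ℂ] H)) : H →L[ℂ] H)) :
    IsAddPosDefFnOn {p : ℤ × ℤ | (p.2 = 0 ∧ |p.1| ≤ m) ∨ (p.1 = 0 ∧ |p.2| ≤ n)} C ∧
    ¬ ∃ Φ : ℤ × ℤ → H →L[ℂ] H, IsAddPosDefFn Φ ∧
        ∀ s ∈ {p : ℤ × ℤ | (p.2 = 0 ∧ |p.1| ≤ m) ∨ (p.1 = 0 ∧ |p.2| ≤ n)}, Φ s = C s := by
  refine ⟨fun N g hg ξ => ?_, ?_⟩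
  · rcases forall_snd_eq_or_forall_fst_eq (g := g) fun i j =>
      (hg i j).imp (fun h => sub_eq_zero.1 h.1) (fun h => sub_eq_zero.1 h.1) with h | h
    · have hC : ∀ i j, C (g j - g i) = ((U₁ ^ ((g j).1 - (g i).1) : unitary (H →L[ℂ] H)) :
          H →L[ℂ] H) := fun i j => by
        have e : g j - g i = ((g j).1 - (g i).1, 0) := Prod.ext rfl (sub_eq_zero.2 (h i j))
        have hS := hg i j
        rw [e] at hS ⊢
        refine hC1 _ ?_
        rcases hS with hS | hS
        · exact hS.2
        · rw [show (g j).1 - (g i).1 = 0 from hS.1, abs_zero]; lia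
      simp only [hC]
      exact unitary.sum_inner_zpow_sub_nonneg U₁ (fun i => (g i).1) ξ
    · have hC : ∀ i j, C (g j - g i) = ((U₂ ^ ((g j).2 - (g i).2) : unitary (H →L[ℂ] H)) :
          H →L[ℂ] H) := fun i j => by
        have e : g j - g i = (0, (g j).2 - (g i).2) := Prod.ext (sub_eq_zero.2 (h i j)) rfl
        have hS := hg i j
        rw [e] at hS ⊢
        refine hC2 _ ?_
        rcases hS with hS | hS
        · rw [show (g j).2 - (g i).2 = 0 from hS.1, abs_zero]; lia
        · exact hS.2
      simp only [hC]
      exact unitary.sum_inner_zpow_sub_nonneg U₂ (fun i => (g i).2) ξ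
  · rintro ⟨Φ, hΦ, hS⟩
    have hΦ1 : ∀ k : ℤ, |k| ≤ m → Φ (k, 0) = ((U₁ ^ k : unitary (H →L[ℂ] H)) : H →L[ℂ] H) :=
      fun k hk => (hS _ (.inl ⟨rfl, hk⟩)).trans (hC1 k hk)
    have hΦ2 : ∀ l : ℤ, |l| ≤ n → Φ (0, l) = ((U₂ ^ l : unitary (H →L[ℂ] H)) : H →L[ℂ] H) :=
      fun l hl => (hS _ (.inr ⟨rfl, hl⟩)).trans (hC2 l hl)
    have hΦ0 : Φ 0 = 1 := by simpa [Prod.mk_zero_zero] using hΦ1 0 (by simp; lia)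
    have a1 : Φ (1, 0) = U₁ := by simpa using hΦ1 1 (by simp; lia)
    have a2 : Φ (0, 1) = U₂ := by simpa using hΦ2 1 (by simp; lia)
    have b1 : Φ (-(1, 0)) = star (U₁ : H →L[ℂ] H) := by
      simpa [← Unitary.star_eq_inv] using hΦ1 (-1) (by simp; lia)
    have b2 : Φ (-(0, 1)) = star (U₂ : H →L[ℂ] H) := by
      simpa [← Unitary.star_eq_inv] using hΦ2 (-1) (by simp; lia)
    have c1 := hΦ.map_add_of_unitary hΦ0 a1 b1 (0, 1)
    have c2 := hΦ.map_add_of_unitary hΦ0 a2 b2 (1, 0)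
    rw [a2] at c1
    rw [a1] at c2
    exact hU (c1.symm.trans ((congrArg Φ (add_comm _ _)).trans c2))
end

section
/- Let G be a discrete amenable group, let G′ be a group equipped with a total order invariant under left and right translations, let g : G → G′ be a group homomorphism, let a′ ∈ G′ with a′ ≥ e′ (e′ the identity of G′), and set S = g⁻¹({x ∈ G′ : a′⁻¹ < x < a′}). Then every positive definite function φ : S → B(H) admits a positive definite extension Φ : G → B(H) with Φ(s) = φ(s) for all s ∈ S. -/
set_option linter.unusedVariables false

open scoped ComplexOrder Pointwise InnerProductSpace BoundedContinuousFunction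

/-- A discrete group `G` is amenable: there is a right-invariant mean, i.e. a positive
normalized linear functional on the bounded (automatically continuous) real functions on `G`
which is invariant under right translations. -/
def HasRightInvariantMean (G : Type*) [Group G] [TopologicalSpace G] [DiscreteTopology G] :
    Prop :=
  ∃ m : (G →ᵇ ℝ) →ₗ[ℝ] ℝ,
    (∀ f : G →ᵇ ℝ, (∀ y, 0 ≤ f y) → 0 ≤ m f) ∧
    m 1 = 1 ∧
    ∀ (x : G) (f : G →ᵇ ℝ),
      m (f.compContinuous (ContinuousMap.mk (fun y => y * x)
        continuous_of_discreteTopology)) = m f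

/-- An operator-valued function on a group is positive definite. -/
def IsPosDefFn {G : Type*} [Group G] {H : Type*} [NormedAddCommGroup H]
    [InnerProductSpace ℂ H] (Φ : G → H →L[ℂ] H) : Prop :=
  ∀ (n : ℕ) (g : Fin n → G) (ξ : Fin n → H),
    0 ≤ ∑ i, ∑ j, ⟪ξ i, Φ ((g i)⁻¹ * g j) (ξ j)⟫_ℂ

/-- An operator-valued function is (partially) positive definite on a subset `S`;
only the values of `φ` on `S` are involved. -/
def IsPosDefFnOn {G : Type*} [Group G] {H : Type*} [NormedAddCommGroup H]
    [InnerProductSpace ℂ H] (S : Set G) (φ : G → H →L[ℂ] H) : Prop :=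
  ∀ (n : ℕ) (g : Fin n → G), (∀ i j, (g i)⁻¹ * g j ∈ S) →
    ∀ ξ : Fin n → H, 0 ≤ ∑ i, ∑ j, ⟪ξ i, φ ((g i)⁻¹ * g j) (ξ j)⟫_ℂ

open Filter Topology ComplexConjugate

section KernelForm

variable {P : Type*}

/-- The sesquilinear form `∑ x ∈ s, ∑ y ∈ s, conj (u x) * k x y * v y` of a scalar kernel `k`
restricted to a finite set `s`. -/
noncomputable def kernelForm (k : P → P → ℂ) (s : Finset P) :
    (P → ℂ) →ₗ⋆[ℂ] (P → ℂ) →ₗ[ℂ] ℂ :=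
  LinearMap.mk₂'ₛₗ (starRingEnd ℂ) (RingHom.id ℂ)
    (fun u v => ∑ x ∈ s, ∑ y ∈ s, conj (u x) * k x y * v y)
    (fun u u' v => by
      simp only [Pi.add_apply, map_add, add_mul, Finset.sum_add_distrib])
    (fun c u v => by
      simp only [Pi.smul_apply, smul_eq_mul, map_mul, Finset.mul_sum, mul_assoc])
    (fun u v v' => by
      simp only [Pi.add_apply, mul_add, Finset.sum_add_distrib])
    (fun c u v => by
      simp only [Pi.smul_apply, smul_eq_mul, RingHom.id_apply, Finset.mul_sum]
      refine Finset.sum_congr rfl fun x _ => Finset.sum_congr rfl fun y _ => ?_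
      ring)

theorem kernelForm_apply (k : P → P → ℂ) (s : Finset P) (u v : P → ℂ) :
    kernelForm k s u v = ∑ x ∈ s, ∑ y ∈ s, conj (u x) * k x y * v y := rfl

theorem kernelForm_single [DecidableEq P] (k : P → P → ℂ) {s : Finset P} {a b : P}
    (ha : a ∈ s) (hb : b ∈ s) :
    kernelForm k s (Pi.single a 1) (Pi.single b 1) = k a b := by
  rw [kernelForm_apply, Finset.sum_eq_single_of_mem a ha, Finset.sum_eq_single_of_mem b hb]
  · simp
  · intro y _ hy
    simp [Pi.single_eq_of_ne hy]
  · intro x _ hx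
    simp [Pi.single_eq_of_ne hx]

/-- A scalar kernel is hermitian and positive semidefinite on a finite set. -/
def IsPosSemidefKernelOn (k : P → P → ℂ) (s : Finset P) : Prop :=
  (∀ x ∈ s, ∀ y ∈ s, conj (k x y) = k y x) ∧ ∀ u : P → ℂ, 0 ≤ kernelForm k s u u

namespace IsPosSemidefKernelOn

variable {k : P → P → ℂ} {s : Finset P}

theorem conj_kernelForm (h : IsPosSemidefKernelOn k s) (u v : P → ℂ) :
    conj (kernelForm k s u v) = kernelForm k s v u := by
  simp only [kernelForm_apply, map_sum, map_mul, Complex.conj_conj]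
  rw [Finset.sum_comm]
  refine Finset.sum_congr rfl fun x hx => Finset.sum_congr rfl fun y hy => ?_
  rw [h.1 y hy x hx]
  ring

theorem norm_kernelForm_sq_le (h : IsPosSemidefKernelOn k s) (u v : P → ℂ) :
    ‖kernelForm k s u v‖ ^ 2 ≤ (kernelForm k s u u).re * (kernelForm k s v v).re := by
  let c : PreInnerProductSpace.Core ℂ (P → ℂ) :=
    { inner := fun u v => kernelForm k s u v
      conj_inner_symm := fun u v => h.conj_kernelForm v u
      re_inner_nonneg := fun u => (Complex.le_def.1 (h.2 u)).1
      add_left := fun u u' v => by simp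
      smul_left := fun u v r => by simp }
  have key := @InnerProductSpace.Core.inner_mul_inner_self_le ℂ (P → ℂ) _ _ _ c u v
  change ‖kernelForm k s u v‖ * ‖kernelForm k s v u‖ ≤
    (kernelForm k s u u).re * (kernelForm k s v v).re at key
  rwa [← h.conj_kernelForm u v, RCLike.norm_conj, ← sq] at key

theorem kernelForm_eq_zero (h : IsPosSemidefKernelOn k s) (u : P → ℂ) {v : P → ℂ}
    (hv : kernelForm k s v v = 0) : kernelForm k s u v = 0 := by
  have := h.norm_kernelForm_sq_le u v
  rw [hv, Complex.zero_re, mul_zero] at this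
  simpa using le_antisymm this (sq_nonneg _)

theorem norm_sq_le (h : IsPosSemidefKernelOn k s) {a b : P} (ha : a ∈ s) (hb : b ∈ s) :
    ‖k a b‖ ^ 2 ≤ (k a a).re * (k b b).re := by
  classical
  have := h.norm_kernelForm_sq_le (Pi.single a 1) (Pi.single b 1)
  rwa [kernelForm_single k ha hb, kernelForm_single k ha ha, kernelForm_single k hb hb] at this

theorem diag_nonneg (h : IsPosSemidefKernelOn k s) {a : P} (ha : a ∈ s) : 0 ≤ k a a := by
  classical
  have := h.2 (Pi.single a 1)
  rwa [kernelForm_single k ha ha] at this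

/-- Over `ℂ`, positivity of the form implies that the kernel is hermitian. -/
theorem of_nonneg (h : ∀ u : P → ℂ, 0 ≤ kernelForm k s u u) : IsPosSemidefKernelOn k s := by
  classical
  refine ⟨fun x hx y hy => ?_, h⟩
  have him : ∀ u, (kernelForm k s u u).im = 0 := fun u => (Complex.le_def.1 (h u)).2.symm
  have hxx := him (Pi.single x 1)
  have hyy := him (Pi.single y 1)
  have h1 := him (Pi.single x 1 + Pi.single y 1)
  have h2 := him (Pi.single x 1 + Complex.I • Pi.single y 1)
  simp only [map_add, LinearMap.add_apply, LinearMap.map_smulₛₗ, LinearMap.smul_apply,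
    RingHom.id_apply, smul_eq_mul, kernelForm_single k hx hx, kernelForm_single k hx hy,
    kernelForm_single k hy hx, kernelForm_single k hy hy, Complex.conj_I, Complex.add_im,
    Complex.add_re, Complex.mul_im, Complex.mul_re, Complex.neg_im, Complex.neg_re, Complex.I_re,
    Complex.I_im] at hxx hyy h1 h2
  apply Complex.ext
  · rw [Complex.conj_re]
    linarith
  · rw [Complex.conj_im]
    linarith

theorem comp {Q : Type*} (h : ∀ s, IsPosSemidefKernelOn k s) (σ : Q → P) (t : Finset Q) :
    IsPosSemidefKernelOn (fun x y => k (σ x) (σ y)) t := by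
  classical
  refine of_nonneg fun u => ?_
  have hmem : ∀ x ∈ t, σ x ∈ t.image σ := fun x hx => Finset.mem_image_of_mem σ hx
  have key := (h (t.image σ)).2 (∑ x ∈ t, u x • Pi.single (σ x) 1)
  convert key using 1
  simp only [map_sum, LinearMap.sum_apply, LinearMap.map_smulₛₗ, LinearMap.smul_apply,
    RingHom.id_apply, smul_eq_mul]
  rw [kernelForm_apply, Finset.sum_comm]
  refine Finset.sum_congr rfl fun y hy => ?_
  rw [Finset.mul_sum]
  refine Finset.sum_congr rfl fun x hx => ?_
  rw [kernelForm_single k (hmem _ ‹_›) (hmem _ ‹_›)]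
  ring

/-- A column of a positive semidefinite matrix lies in the range of the complementary block. -/
theorem exists_solution [DecidableEq P] {B : Finset P} {p : P} (hp : p ∉ B)
    (h : IsPosSemidefKernelOn k (insert p B)) :
    ∃ w : P → ℂ, (∀ x, x ∉ B → w x = 0) ∧ ∀ x ∈ B, ∑ y ∈ B, k x y * w y = k x p := by
  let M : Matrix B B ℂ := fun x y => k x y
  let T : EuclideanSpace ℂ B →ₗ[ℂ] EuclideanSpace ℂ B := Matrix.toEuclideanLin M
  have hTapply : ∀ (v : EuclideanSpace ℂ B) (x : B), T v x = ∑ y : B, k x y * v y :=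
    fun _ _ => rfl
  have hM : M.IsHermitian := by
    ext x y
    exact h.1 y (Finset.mem_insert_of_mem y.2) x (Finset.mem_insert_of_mem x.2)
  have hT : T.IsSymmetric := Matrix.isSymmetric_toEuclideanLin_iff.2 hM
  let b : EuclideanSpace ℂ B := WithLp.toLp 2 fun x => k x p
  have hb : b ∈ LinearMap.range T := by
    rw [← Submodule.orthogonal_orthogonal (LinearMap.range T), hT.orthogonal_range,
      Submodule.mem_orthogonal]
    intro u hu
    have hTu : ∀ x : B, ∑ y : B, k x y * u y = 0 := fun x => by
      rw [← hTapply, LinearMap.mem_ker.1 hu, PiLp.zero_apply]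
    let v : P → ℂ := fun x => if hx : x ∈ B then u ⟨x, hx⟩ else 0
    have hvp : v p = 0 := by simp [v, hp]
    have hvB : ∀ f : P → ℂ, ∑ y ∈ B, f y * v y = ∑ y : B, f y * u y := fun f => by
      rw [← Finset.sum_coe_sort]
      exact Finset.sum_congr rfl fun y _ => by simp [v]
    have hvv : kernelForm k (insert p B) v v = 0 := by
      rw [kernelForm_apply, Finset.sum_insert hp, hvp]
      simp only [map_zero, zero_mul, Finset.sum_const_zero, zero_add]
      refine Finset.sum_eq_zero fun x hx => ?_
      rw [Finset.sum_insert hp, hvp, mul_zero, zero_add]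
      simp only [mul_assoc]
      rw [← Finset.mul_sum, hvB, hTu ⟨x, hx⟩, mul_zero]
    have hpv := h.kernelForm_eq_zero (Pi.single p 1) hvv
    rw [kernelForm_apply, Finset.sum_eq_single_of_mem p (Finset.mem_insert_self _ _)
      (fun x _ hx => by simp [Pi.single_eq_of_ne hx]), Finset.sum_insert hp, hvp] at hpv
    simp only [Pi.single_eq_same, map_one, one_mul, mul_zero, zero_add] at hpv
    rw [hvB] at hpv
    rw [← inner_conj_symm, PiLp.inner_apply]
    have : ∑ y : B, inner ℂ (b y) (u y) = 0 := by
      rw [← hpv]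
      refine Finset.sum_congr rfl fun y _ => ?_
      rw [← h.1 y (Finset.mem_insert_of_mem y.2) p (Finset.mem_insert_self _ _)]
      simp [b, mul_comm]
    rw [this, map_zero]
  obtain ⟨w, hw⟩ := hb
  refine ⟨fun x => if hx : x ∈ B then w ⟨x, hx⟩ else 0, fun x hx => by simp [hx],
    fun x hx => ?_⟩
  have hbx : b ⟨x, hx⟩ = k x p := rfl
  rw [← hbx, ← hw, hTapply, ← Finset.sum_coe_sort]
  exact Finset.sum_congr rfl fun y _ => by simp

end IsPosSemidefKernelOn

/-- Gluing one point onto a positive semidefinite kernel along a finite set `B` of neighbours. -/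
theorem exists_extension_insert [DecidableEq P] {k k₀ : P → P → ℂ} {s B : Finset P} {p : P}
    (hp : p ∉ s) (hBs : B ⊆ s) (hk : IsPosSemidefKernelOn k s)
    (hk₀ : IsPosSemidefKernelOn k₀ (insert p B)) (hB : ∀ x ∈ B, ∀ y ∈ B, k x y = k₀ x y) :
    ∃ k' : P → P → ℂ, IsPosSemidefKernelOn k' (insert p s) ∧
      (∀ x ∈ s, ∀ y ∈ s, k' x y = k x y) ∧ k' p p = k₀ p p ∧
      ∀ x ∈ B, k' x p = k₀ x p ∧ k' p x = k₀ p x := by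
  have hpB : p ∉ B := fun h => hp (hBs h)
  obtain ⟨w, hw0, hw⟩ := hk₀.exists_solution hpB
  have hwp : w p = 0 := hw0 p hpB
  let c : P → ℂ := fun x => ∑ y ∈ s, k x y * w y
  have hcB : ∀ x ∈ B, c x = k₀ x p := fun x hx => by
    rw [← hw x hx]
    refine (Finset.sum_subset hBs fun y _ hy => by simp [hw0 y hy]).symm.trans ?_
    exact Finset.sum_congr rfl fun y hy => by rw [hB x hx y hy]
  have hFc : ∀ u, kernelForm k s u w = ∑ x ∈ s, conj (u x) * c x := fun u => by
    rw [kernelForm_apply]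
    refine Finset.sum_congr rfl fun x _ => ?_
    simp only [mul_assoc, c, Finset.mul_sum]
  have hcF : ∀ u, kernelForm k s w u = ∑ x ∈ s, conj (c x) * u x := fun u => by
    rw [← hk.conj_kernelForm, hFc, map_sum]
    exact Finset.sum_congr rfl fun x _ => by simp [mul_comm]
  have hpp : conj (k₀ p p) = k₀ p p :=
    hk₀.1 p (Finset.mem_insert_self _ _) p (Finset.mem_insert_self _ _)
  have hschur : 0 ≤ k₀ p p - kernelForm k s w w := by
    have h1 := hk₀.2 (Pi.single p 1 - w)
    have h2 : kernelForm k s w w = ∑ y ∈ B, k₀ p y * w y := by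
      rw [hcF]
      refine (Finset.sum_subset hBs fun y _ hy => by simp [hw0 y hy]).symm.trans ?_
      refine Finset.sum_congr rfl fun y hy => ?_
      rw [hcB y hy, hk₀.1 y (Finset.mem_insert_of_mem hy) p (Finset.mem_insert_self _ _)]
    have hne : ∀ x ∈ B, x ≠ p := fun x hx h => hpB (h ▸ hx)
    have h3 : kernelForm k₀ (insert p B) (Pi.single p 1 - w) (Pi.single p 1 - w) =
        k₀ p p - ∑ y ∈ B, k₀ p y * w y := by
      rw [kernelForm_apply, Finset.sum_insert hpB, Finset.sum_eq_zero (s := B), add_zero,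
        Finset.sum_insert hpB, sub_eq_add_neg (k₀ p p), ← Finset.sum_neg_distrib]
      · congr 1
        · simp [hwp]
        · exact Finset.sum_congr rfl fun y hy => by simp [hwp, hne y hy]
      · intro x hx
        rw [Finset.sum_insert hpB]
        have : ∑ y ∈ B, conj ((Pi.single p 1 - w : P → ℂ) x) * k₀ x y *
            (Pi.single p 1 - w : P → ℂ) y =
            conj (w x) * ∑ y ∈ B, k₀ x y * w y := by
          rw [Finset.mul_sum]
          exact Finset.sum_congr rfl fun y hy => by simp [hne y hy, hne x hx, mul_assoc]
        rw [this, hw x hx]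
        simp [hwp, hne x hx]
    rwa [h3, ← h2] at h1
  let k' : P → P → ℂ := fun x y =>
    if x = p then (if y = p then k₀ p p else conj (c y)) else if y = p then c x else k x y
  have hne : ∀ x ∈ s, x ≠ p := fun x hx h => hp (h ▸ hx)
  have hk'pp : k' p p = k₀ p p := by simp [k']
  have hk'xp : ∀ x ∈ s, k' x p = c x := fun x hx => by simp [k', hne x hx]
  have hk'px : ∀ x ∈ s, k' p x = conj (c x) := fun x hx => by simp [k', hne x hx]
  have hk'xy : ∀ x ∈ s, ∀ y ∈ s, k' x y = k x y := fun x hx y hy => by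
    simp [k', hne x hx, hne y hy]
  refine ⟨k', ⟨?_, fun u => ?_⟩, hk'xy, hk'pp, fun x hx => ⟨?_, ?_⟩⟩
  · intro x hx y hy
    rcases Finset.mem_insert.1 hx with hx | hx <;> rcases Finset.mem_insert.1 hy with hy | hy
    · rw [hx, hy, hk'pp, hpp]
    · rw [hx, hk'px y hy, hk'xp y hy, Complex.conj_conj]
    · rw [hy, hk'px x hx, hk'xp x hx]
    · rw [hk'xy x hx y hy, hk'xy y hy x hx, hk.1 x hx y hy]
  · have hform : kernelForm k' (insert p s) u u =
        kernelForm k s (u + u p • w) (u + u p • w) +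
          conj (u p) * u p * (k₀ p p - kernelForm k s w w) := by
      have h1 : kernelForm k' (insert p s) u u = conj (u p) * u p * k₀ p p +
          conj (u p) * kernelForm k s w u + u p * kernelForm k s u w + kernelForm k s u u := by
        have hrow : ∑ y ∈ s, conj (u p) * k' p y * u y = conj (u p) * kernelForm k s w u := by
          rw [hcF u, Finset.mul_sum]
          exact Finset.sum_congr rfl fun y hy => by rw [hk'px y hy, mul_assoc]
        have hcol : ∑ x ∈ s, conj (u x) * k' x p * u p = u p * kernelForm k s u w := by
          rw [hFc u, Finset.mul_sum]
          exact Finset.sum_congr rfl fun x hx => by rw [hk'xp x hx, mul_comm]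
        have hmid : ∑ x ∈ s, ∑ y ∈ s, conj (u x) * k' x y * u y = kernelForm k s u u :=
          Finset.sum_congr rfl fun x hx => Finset.sum_congr rfl fun y hy => by
            rw [hk'xy x hx y hy]
        rw [kernelForm_apply, Finset.sum_insert hp, Finset.sum_insert hp, hrow, hk'pp]
        simp only [Finset.sum_insert hp, Finset.sum_add_distrib, hcol, hmid]
        ring
      rw [h1]
      simp only [map_add, LinearMap.add_apply, LinearMap.map_smulₛₗ, LinearMap.smul_apply,
        smul_eq_mul, RingHom.id_apply]
      ring
    rw [hform]
    refine add_nonneg (hk.2 _) (mul_nonneg ?_ hschur)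
    rw [mul_comm]
    exact Complex.mul_conj (u p) ▸ by exact_mod_cast Complex.normSq_nonneg _
  · rw [hk'xp x (hBs hx), hcB x hx]
  · rw [hk'px x (hBs hx), hcB x hx,
      hk₀.1 x (Finset.mem_insert_of_mem hx) p (Finset.mem_insert_self _ _)]

/-- A partially defined positive semidefinite kernel whose pattern `A` is an interval graph for
a total preorder can be completed on every finite set. -/
theorem exists_completion_finset {L : Type*} [LinearOrder L] (f : P → L) (A : P → P → Prop)
    (hrefl : ∀ x, A x x) (hsymm : ∀ x y, A x y → A y x)
    (hint : ∀ x y z, f x ≤ f y → f y ≤ f z → A x z → A x y)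
    (k₀ : P → P → ℂ)
    (hk₀ : ∀ t : Finset P, (∀ x ∈ t, ∀ y ∈ t, A x y) → IsPosSemidefKernelOn k₀ t)
    (s : Finset P) :
    ∃ k : P → P → ℂ, IsPosSemidefKernelOn k s ∧ ∀ x ∈ s, ∀ y ∈ s, A x y → k x y = k₀ x y := by
  classical
  induction s using Finset.induction_on_max_value f with
  | empty => exact ⟨k₀, ⟨by simp, fun u => by simp [kernelForm_apply]⟩, by simp⟩
  | insert p s hp hmax ih =>
    obtain ⟨k, hk, hkk₀⟩ := ih
    have hclique : ∀ x ∈ s.filter (A · p), ∀ y ∈ s.filter (A · p), A x y := by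
      intro x hx y hy
      rw [Finset.mem_filter] at hx hy
      rcases le_total (f x) (f y) with hxy | hxy
      · exact hint x y p hxy (hmax y hy.1) hx.2
      · exact hsymm _ _ (hint y x p hxy (hmax x hx.1) hy.2)
    have hclique' : ∀ x ∈ insert p (s.filter (A · p)), ∀ y ∈ insert p (s.filter (A · p)),
        A x y := by
      intro x hx y hy
      rcases Finset.mem_insert.1 hx with hx | hx <;> rcases Finset.mem_insert.1 hy with hy | hy
      · exact hx ▸ hy ▸ hrefl _
      · exact hx ▸ hsymm _ _ (Finset.mem_filter.1 hy).2
      · exact hy ▸ (Finset.mem_filter.1 hx).2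
      · exact hclique x hx y hy
    obtain ⟨k', hk', hs, hpp, hB⟩ := exists_extension_insert hp (Finset.filter_subset _ s) hk
      (hk₀ _ hclique') (fun x hx y hy => hkk₀ x (Finset.mem_filter.1 hx).1 y
        (Finset.mem_filter.1 hy).1 (hclique x hx y hy))
    refine ⟨k', hk', fun x hx y hy hxy => ?_⟩
    rcases Finset.mem_insert.1 hx with hx | hx <;> rcases Finset.mem_insert.1 hy with hy | hy
    · rw [hx, hy, hpp]
    · rw [hx] at hxy ⊢
      exact (hB y (Finset.mem_filter.2 ⟨hy, hsymm _ _ hxy⟩)).2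
    · rw [hy] at hxy ⊢
      exact (hB x (Finset.mem_filter.2 ⟨hx, hxy⟩)).1
    · rw [hs x hx y hy, hkk₀ x hx y hy hxy]

/-- Completion on an arbitrary set, by compactness. -/
theorem exists_completion {L : Type*} [LinearOrder L] (f : P → L) (A : P → P → Prop)
    (hrefl : ∀ x, A x x) (hsymm : ∀ x y, A x y → A y x)
    (hint : ∀ x y z, f x ≤ f y → f y ≤ f z → A x z → A x y)
    (k₀ : P → P → ℂ)
    (hk₀ : ∀ t : Finset P, (∀ x ∈ t, ∀ y ∈ t, A x y) → IsPosSemidefKernelOn k₀ t) :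
    ∃ k : P → P → ℂ, (∀ s, IsPosSemidefKernelOn k s) ∧ ∀ x y, A x y → k x y = k₀ x y := by
  classical
  choose K hK hKA using exists_completion_finset f A hrefl hsymm hint k₀ hk₀
  let U : Ultrafilter (Finset P) := Ultrafilter.of atTop
  have hU : (U : Filter (Finset P)) ≤ atTop := Ultrafilter.of_le _
  have hmem : ∀ x, ∀ᶠ s in (U : Filter (Finset P)), x ∈ s := fun x =>
    hU ((eventually_ge_atTop {x}).mono fun s hs => Finset.singleton_subset_iff.1 hs)
  have hlim : ∀ x y, ∃ l, Tendsto (fun s => K s x y) (U : Filter (Finset P)) (𝓝 l) := by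
    intro x y
    have hbd : ∀ᶠ s in (U : Filter (Finset P)), K s x y ∈
        Metric.closedBall (0 : ℂ) (√((k₀ x x).re * (k₀ y y).re)) := by
      filter_upwards [hmem x, hmem y] with s hx hy
      rw [mem_closedBall_zero_iff]
      refine Real.le_sqrt_of_sq_le ?_
      rw [← hKA s x hx x hx (hrefl x), ← hKA s y hy y hy (hrefl y)]
      exact (hK s).norm_sq_le hx hy
    obtain ⟨l, -, hl⟩ := (isCompact_closedBall (0 : ℂ) _).ultrafilter_le_nhds
      (U.map fun s => K s x y) (le_principal_iff.2 hbd)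
    exact ⟨l, hl⟩
  choose k hk using hlim
  refine ⟨k, fun s => ⟨fun x hx y hy => ?_, fun u => ?_⟩, fun x y hxy => ?_⟩
  · refine tendsto_nhds_unique ((Complex.continuous_conj.tendsto _).comp (hk x y))
      ((hk y x).congr' ?_)
    filter_upwards [hmem x, hmem y] with t hx hy
    exact ((hK t).1 x hx y hy).symm
  · have ht : Tendsto (fun t => kernelForm (K t) s u u) (U : Filter (Finset P)) (𝓝 (kernelForm k s u u)) := by
      simp only [kernelForm_apply]
      exact tendsto_finsetSum _ fun x _ => tendsto_finsetSum _ fun y _ =>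
        ((hk x y).const_mul _).mul_const _
    refine ge_of_tendsto ht ?_
    filter_upwards [hU (eventually_ge_atTop s)] with t hst
    let v : P → ℂ := fun x => if x ∈ s then u x else 0
    have : kernelForm (K t) s u u = kernelForm (K t) t v v := by
      rw [kernelForm_apply, kernelForm_apply]
      refine (Finset.sum_congr rfl fun x hx => ?_).trans (Finset.sum_subset hst fun x _ hx => ?_)
      · refine (Finset.sum_congr rfl fun y hy => ?_).trans
          (Finset.sum_subset hst fun y _ hy => ?_)
        · simp [v, hx, hy]
        · simp [v, hy]
      · simp [v, hx]
    rw [this]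
    exact (hK t).2 v
  · refine tendsto_nhds_unique (hk x y) (tendsto_const_nhds.congr' ?_)
    filter_upwards [hmem x, hmem y] with t hx hy
    exact (hKA t x hx y hy hxy).symm

end KernelForm

section Mean

variable {G : Type*} [Group G] [TopologicalSpace G] [DiscreteTopology G]

/-- The complexification of a right-invariant mean. -/
theorem HasRightInvariantMean.exists_complex_mean (hamen : HasRightInvariantMean G) :
    ∃ m : (G →ᵇ ℂ) →ₗ[ℂ] ℂ,
      (∀ f : G →ᵇ ℂ, (∀ y, 0 ≤ f y) → 0 ≤ m f) ∧
      (∀ (f : G →ᵇ ℂ) (c : ℂ), (∀ y, f y = c) → m f = c) ∧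
      ∀ (x : G) (f f' : G →ᵇ ℂ), (∀ y, f' y = f (y * x)) → m f' = m f := by
  obtain ⟨m, hpos, hone, hinv⟩ := hamen
  let reMap : (G →ᵇ ℂ) →ₗ[ℝ] (G →ᵇ ℝ) := (Complex.reCLM.compLeftContinuousBounded G).toLinearMap
  have hre : ∀ f y, reMap f y = (f y).re := fun _ _ => rfl
  have hconst : ∀ (f : G →ᵇ ℝ) (c : ℝ), (∀ y, f y = c) → m f = c := fun f c hf => by
    have : f = c • 1 := by
      ext y
      simp [hf y]
    rw [this, map_smul, hone, smul_eq_mul, mul_one]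
  let M : (G →ᵇ ℂ) →ₗ[ℂ] ℂ := Module.Dual.extendRCLike (m ∘ₗ reMap)
  have hM : ∀ f, M f = (m (reMap f) : ℂ) - Complex.I * (m (reMap (Complex.I • f)) : ℂ) :=
    fun _ => rfl
  refine ⟨M, fun f hf => ?_, fun f c hf => ?_, fun x f f' hf => ?_⟩
  · have h0 : m (reMap (Complex.I • f)) = 0 := hconst _ 0 fun y => by
      rw [hre, BoundedContinuousFunction.smul_apply, smul_eq_mul, Complex.I_mul_re,
        ← (Complex.le_def.1 (hf y)).2, Complex.zero_im, neg_zero]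
    rw [hM, h0, Complex.ofReal_zero, mul_zero, sub_zero]
    exact_mod_cast hpos _ fun y => (Complex.le_def.1 (hf y)).1
  · rw [hM, hconst (reMap f) c.re fun y => by rw [hre, hf],
      hconst (reMap (Complex.I • f)) (-c.im) fun y => by
        rw [hre, BoundedContinuousFunction.smul_apply, hf, smul_eq_mul, Complex.I_mul_re]]
    apply Complex.ext <;> simp
  · have hcomp : ∀ h h' : G →ᵇ ℂ, (∀ y, h' y = h (y * x)) → m (reMap h') = m (reMap h) :=
      fun h h' hh => by
        rw [← hinv x (reMap h)]
        congr 1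
        ext y
        exact congrArg Complex.re (hh y)
    rw [hM, hM, hcomp f f' hf, hcomp (Complex.I • f) (Complex.I • f') fun y => by
      rw [BoundedContinuousFunction.smul_apply, BoundedContinuousFunction.smul_apply, hf y]]

/-- Averaging a positive semidefinite kernel on `G × T` over left translations of `G`. -/
theorem HasRightInvariantMean.exists_invariant_kernel (hamen : HasRightInvariantMean G)
    {T : Type*} (K : G × T → G × T → ℂ) (hK : ∀ s, IsPosSemidefKernelOn K s) (D : T → ℝ)
    (hD : ∀ x t, (K (x, t) (x, t)).re = D t) :
    ∃ M : G × T → G × T → ℂ, (∀ s, IsPosSemidefKernelOn M s) ∧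
      (∀ z x y t t', M (z * x, t) (z * y, t') = M (x, t) (y, t')) ∧
      ∀ x y t t' c, (∀ z, K (z * x, t) (z * y, t') = c) → M (x, t) (y, t') = c := by
  classical
  obtain ⟨m, hpos, hconst, hinv⟩ := hamen.exists_complex_mean
  have hbound : ∀ p q : G × T, ∀ z, ‖K (z * p.1, p.2) (z * q.1, q.2)‖ ≤ √(D p.2 * D q.2) := by
    intro p q z
    refine Real.le_sqrt_of_sq_le ?_
    rw [← hD (z * p.1) p.2, ← hD (z * q.1) q.2]
    exact (hK {(z * p.1, p.2), (z * q.1, q.2)}).norm_sq_le (by simp) (by simp)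
  let F : G × T → G × T → G →ᵇ ℂ := fun p q =>
    BoundedContinuousFunction.ofNormedAddCommGroupDiscrete
      (fun z => K (z * p.1, p.2) (z * q.1, q.2)) _ (hbound p q)
  have hF : ∀ p q z, F p q z = K (z * p.1, p.2) (z * q.1, q.2) := fun _ _ _ => rfl
  refine ⟨fun p q => m (F p q), fun s => .of_nonneg fun u => ?_, fun z x y t t' => ?_,
    fun x y t t' c hc => hconst _ c hc⟩
  · have hform : kernelForm (fun p q => m (F p q)) s u u =
        m (∑ p ∈ s, ∑ q ∈ s, (conj (u p) * u q) • F p q) := by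
      simp only [kernelForm_apply, map_sum, map_smul, smul_eq_mul]
      exact Finset.sum_congr rfl fun p _ => Finset.sum_congr rfl fun q _ => by ring
    rw [hform]
    refine hpos _ fun z => ?_
    have h := (IsPosSemidefKernelOn.comp hK (fun p : G × T => (z * p.1, p.2)) s).2 u
    rw [kernelForm_apply] at h
    simp only [BoundedContinuousFunction.sum_apply, BoundedContinuousFunction.smul_apply, hF,
      smul_eq_mul]
    refine h.trans_eq (Finset.sum_congr rfl fun p _ => Finset.sum_congr rfl fun q _ => ?_)
    ring
  · refine hinv z _ _ fun w => ?_
    simp only [hF, mul_assoc]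

end Mean

section Operator

variable {X H : Type*} [NormedAddCommGroup H] [InnerProductSpace ℂ H]

/-- If the diagonal blocks of a positive semidefinite kernel on `X × H` are given by a bounded
operator, then so are all blocks. -/
theorem exists_operator_of_kernel [CompleteSpace H] (M : X × H → X × H → ℂ)
    (hM : ∀ s, IsPosSemidefKernelOn M s) (T : H →L[ℂ] H)
    (hT : ∀ x ξ η, M (x, ξ) (x, η) = ⟪ξ, T η⟫_ℂ) (x y : X) :
    ∃ Ψ : H →L[ℂ] H, ∀ ξ η, M (x, ξ) (y, η) = ⟪ξ, Ψ η⟫_ℂ := by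
  classical
  have hlin : ∀ (p : X × H) (y : X) (c : ℂ) (η η' : H),
      M p (y, c • η + η') = c * M p (y, η) + M p (y, η') := by
    intro p y c η η'
    let s : Finset (X × H) := {p, (y, c • η + η'), (y, η), (y, η')}
    have h0 : p ∈ s := by simp [s]
    have h1 : (y, c • η + η') ∈ s := by simp [s]
    have h2 : (y, η) ∈ s := by simp [s]
    have h3 : (y, η') ∈ s := by simp [s]
    let e : X × H → (X × H → ℂ) := fun q => Pi.single q 1
    have he : ∀ q ∈ s, ∀ q' ∈ s, kernelForm M s (e q) (e q') = M q q' :=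
      fun q hq q' hq' => kernelForm_single M hq hq'
    have hnull : kernelForm M s (e (y, c • η + η') - c • e (y, η) - e (y, η'))
        (e (y, c • η + η') - c • e (y, η) - e (y, η')) = 0 := by
      simp only [map_sub, LinearMap.sub_apply, LinearMap.map_smulₛₗ, LinearMap.smul_apply,
        smul_eq_mul, he _ h1 _ h1, he _ h1 _ h2, he _ h1 _ h3, he _ h2 _ h1,
        he _ h2 _ h2, he _ h2 _ h3, he _ h3 _ h1, he _ h3 _ h2, he _ h3 _ h3, hT, map_add,
        map_smul, inner_add_left, inner_add_right, inner_smul_left, inner_smul_right]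
      ring
    have := (hM s).kernelForm_eq_zero (e p) hnull
    simp only [map_sub, LinearMap.map_smulₛₗ, RingHom.id_apply, smul_eq_mul, he _ h0 _ h1,
      he _ h0 _ h2, he _ h0 _ h3] at this
    linear_combination this
  have hherm : ∀ p q, conj (M p q) = M q p := fun p q =>
    (hM {p, q}).1 p (by simp) q (by simp)
  have hbound : ∀ ξ η, ‖M (y, η) (x, ξ)‖ ≤ ‖T‖ * ‖η‖ * ‖ξ‖ := by
    intro ξ η
    have hdiag : ∀ z ζ, (M (z, ζ) (z, ζ)).re ≤ ‖T‖ * ‖ζ‖ ^ 2 := fun z ζ => by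
      rw [hT]
      calc (⟪ζ, T ζ⟫_ℂ).re ≤ ‖⟪ζ, T ζ⟫_ℂ‖ := Complex.re_le_norm _
        _ ≤ ‖ζ‖ * ‖T ζ‖ := norm_inner_le_norm _ _
        _ ≤ ‖ζ‖ * (‖T‖ * ‖ζ‖) := by gcongr; exact T.le_opNorm ζ
        _ = ‖T‖ * ‖ζ‖ ^ 2 := by ring
    refine (sq_le_sq₀ (norm_nonneg _) (by positivity)).1 ?_
    calc ‖M (y, η) (x, ξ)‖ ^ 2 ≤ (M (y, η) (y, η)).re * (M (x, ξ) (x, ξ)).re :=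
          (hM {(y, η), (x, ξ)}).norm_sq_le (by simp) (by simp)
      _ ≤ (‖T‖ * ‖η‖ ^ 2) * (‖T‖ * ‖ξ‖ ^ 2) := by
          refine mul_le_mul (hdiag y η) (hdiag x ξ) ?_ (by positivity)
          exact (Complex.le_def.1 ((hM {(x, ξ)}).diag_nonneg (by simp))).1
      _ = (‖T‖ * ‖η‖ * ‖ξ‖) ^ 2 := by ring
  have hadd : ∀ p z ξ ξ', M p (z, ξ + ξ') = M p (z, ξ) + M p (z, ξ') := fun p z ξ ξ' => by
    have := hlin p z 1 ξ ξ'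
    rwa [one_smul, one_mul] at this
  have hsmul : ∀ p z (c : ℂ) ξ, M p (z, c • ξ) = c * M p (z, ξ) := fun p z c ξ => by
    have h0 : M p (z, 0) = 0 := by
      have := hadd p z 0 0
      rwa [add_zero, left_eq_add] at this
    have := hlin p z c ξ 0
    rwa [add_zero, h0, add_zero] at this
  let B : H →ₗ⋆[ℂ] H →ₗ[ℂ] ℂ :=
    LinearMap.mk₂'ₛₗ (starRingEnd ℂ) (RingHom.id ℂ) (fun η ξ => M (y, η) (x, ξ))
      (fun η η' ξ => by
        rw [← hherm, hadd, map_add, hherm, hherm])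
      (fun c η ξ => by
        rw [← hherm, hsmul, map_mul, hherm, smul_eq_mul])
      (fun η ξ ξ' => hadd _ _ _ _)
      (fun c η ξ => hsmul _ _ _ _)
  refine ⟨InnerProductSpace.continuousLinearMapOfBilin
    (B.mkContinuous₂ ‖T‖ fun η ξ => hbound ξ η), fun ξ η => ?_⟩
  rw [← inner_conj_symm, InnerProductSpace.continuousLinearMapOfBilin_apply, ← hherm]
  rfl

/-- The scalar kernel on `G × H` attached to a partially positive definite function. -/
theorem IsPosDefFnOn.isPosSemidefKernelOn {G : Type*} [Group G] {S : Set G} {φ : G → H →L[ℂ] H}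
    (hφ : IsPosDefFnOn S φ) (t : Finset (G × H))
    (ht : ∀ p ∈ t, ∀ q ∈ t, p.1⁻¹ * q.1 ∈ S) :
    IsPosSemidefKernelOn (fun p q : G × H => ⟪p.2, φ (p.1⁻¹ * q.1) q.2⟫_ℂ) t := by
  refine .of_nonneg fun u => ?_
  let e := t.equivFin.symm
  have h := hφ t.card (fun i => (e i).1.1) (fun i j => ht _ (e i).2 _ (e j).2)
    (fun i => u (e i) • (e i).1.2)
  refine h.trans_eq ?_
  rw [kernelForm_apply, ← Finset.sum_coe_sort t, ← e.sum_comp]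
  refine Finset.sum_congr rfl fun i _ => ?_
  rw [← Finset.sum_coe_sort t, ← e.sum_comp]
  refine Finset.sum_congr rfl fun j _ => ?_
  rw [map_smul, inner_smul_left, inner_smul_right]
  ring

end Operator

/-- If `G` is discrete amenable, `G'` is a group with a bi-invariant total order,
`g : G → G'` is a homomorphism, `a' ≥ 1` and `S = g⁻¹((a'⁻¹, a'))`, then every positive
definite operator function on `S` extends to a positive definite function on `G`. -/
theorem ordered_preimage_extension
    {G : Type*} [Group G] [TopologicalSpace G] [DiscreteTopology G]
    {G' : Type*} [Group G'] [LinearOrder G']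
    [CovariantClass G' G' (· * ·) (· ≤ ·)]
    [CovariantClass G' G' (Function.swap (· * ·)) (· ≤ ·)]
    {H : Type*} [NormedAddCommGroup H] [InnerProductSpace ℂ H] [CompleteSpace H]
    (hamen : HasRightInvariantMean G)
    (g : G →* G') (a' : G') (ha' : 1 ≤ a')
    (φ : G → H →L[ℂ] H)
    (hφ : IsPosDefFnOn (g ⁻¹' {x : G' | a'⁻¹ < x ∧ x < a'}) φ) :
    ∃ Φ : G → H →L[ℂ] H, IsPosDefFn Φ ∧
      ∀ s ∈ g ⁻¹' {x : G' | a'⁻¹ < x ∧ x < a'}, Φ s = φ s := by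
  rcases ha'.eq_or_lt with rfl | ha
  · refine ⟨0, fun n x ξ => by simp, fun s hs => ?_⟩
    obtain ⟨h1, h2⟩ := hs
    rw [inv_one] at h1
    exact absurd h2 h1.not_gt
  set S : Set G := g ⁻¹' {x : G' | a'⁻¹ < x ∧ x < a'} with hS
  have hinv : a'⁻¹ < 1 := Left.inv_lt_one_iff.2 ha
  have hone : (1 : G) ∈ S := by simp [hS, ha]
  have hsymm : ∀ x y : G, x⁻¹ * y ∈ S → y⁻¹ * x ∈ S := by
    rintro x y ⟨h1, h2⟩
    have : g (y⁻¹ * x) = (g (x⁻¹ * y))⁻¹ := by simp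
    refine ⟨?_, ?_⟩
    · rw [this]
      exact inv_lt_inv_iff.2 h2
    · rw [this]
      exact inv_lt'.1 h1
  obtain ⟨K, hK, hKφ⟩ := exists_completion (P := G × H) (fun p => g p.1)
    (fun p q => p.1⁻¹ * q.1 ∈ S) (fun p => by rwa [inv_mul_cancel])
    (fun p q => hsymm p.1 q.1)
    (fun p q r hpq hqr hpr => by
      have h1 : 1 ≤ g (p.1⁻¹ * q.1) := by
        rw [map_mul, map_inv]
        exact le_inv_mul_iff_mul_le.2 (by rwa [mul_one])
      have h2 : g (p.1⁻¹ * q.1) ≤ g (p.1⁻¹ * r.1) := by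
        rw [map_mul, map_mul]
        exact mul_le_mul_right hqr _
      exact ⟨hinv.trans_le h1, h2.trans_lt hpr.2⟩)
    (fun p q => ⟪p.2, φ (p.1⁻¹ * q.1) q.2⟫_ℂ) hφ.isPosSemidefKernelOn
  obtain ⟨M, hM, hMinv, hMK⟩ := hamen.exists_invariant_kernel K hK
    (fun ξ => (⟪ξ, φ 1 ξ⟫_ℂ).re) (fun x ξ => by
      rw [hKφ _ _ (by rwa [inv_mul_cancel]), inv_mul_cancel])
  have hMφ : ∀ x y : G, x⁻¹ * y ∈ S → ∀ ξ η, M (x, ξ) (y, η) = ⟪ξ, φ (x⁻¹ * y) η⟫_ℂ := by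
    intro x y hxy ξ η
    refine hMK x y ξ η _ fun z => ?_
    have hz : (z * x)⁻¹ * (z * y) = x⁻¹ * y := by group
    rw [hKφ _ _ (by rwa [hz]), hz]
  choose Φ hΦ using exists_operator_of_kernel M hM (φ 1) (fun x ξ η => by
    rw [hMφ x x (by rwa [inv_mul_cancel]), inv_mul_cancel]) 1
  refine ⟨Φ, fun n x ξ => ?_, fun s hs => ?_⟩
  · have h := (IsPosSemidefKernelOn.comp hM (fun i : Fin n => (x i, ξ i)) Finset.univ).2 1
    refine h.trans_eq ?_
    rw [kernelForm_apply]
    refine Finset.sum_congr rfl fun i _ => Finset.sum_congr rfl fun j _ => ?_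
    rw [← hΦ, ← hMinv (x i) 1 ((x i)⁻¹ * x j)]
    simp
  · ext η
    refine ext_inner_left ℂ fun ξ => ?_
    rw [← hΦ, hMφ 1 s (by rwa [inv_one, one_mul]), inv_one, one_mul]
end

section
/- Let α, β ∈ ℝ and a > 0, and set S = {(m,n) ∈ ℤ² : |αm + βn| < a}. Then every positive definite function φ : S → B(H) admits a positive definite extension Φ : ℤ² → B(H) with Φ(s) = φ(s) for all s ∈ S. -/
set_option linter.unusedVariables false

open scoped ComplexOrder Pointwise InnerProductSpace BoundedContinuousFunction

open Filter Topology ComplexConjugate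

section Complex

theorem Complex.eq_conj_and_sq_norm_le_of_forall_nonneg {p q : ℝ} {z w : ℂ}
    (h : ∀ c : ℂ, 0 ≤ (p : ℂ) + c * w + conj c * z + conj c * c * q) :
    w = conj z ∧ ‖z‖ ^ 2 ≤ p * q := by
  have key : w = conj z := by
    have h1 := (Complex.nonneg_iff.1 (h 1)).2
    have h2 := (Complex.nonneg_iff.1 (h Complex.I)).2
    simp at h1 h2
    apply Complex.ext <;> simp <;> linarith
  refine ⟨key, ?_⟩
  have h3 : ∀ t : ℝ, 0 ≤ (‖z‖ ^ 2 * q) * (t * t) + (2 * ‖z‖ ^ 2) * t + p := by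
    intro t
    have h4 := (Complex.nonneg_iff.1 (h (t * z))).1
    rw [key] at h4
    have hz : ‖z‖ ^ 2 = z.re * z.re + z.im * z.im := by
      rw [Complex.sq_norm, Complex.normSq_apply]
    rw [hz]
    simp at h4
    nlinarith
  have h5 := discrim_le_zero h3
  rw [discrim] at h5
  rcases eq_or_ne ‖z‖ 0 with h0 | h0
  · have hp : 0 ≤ p := by simpa using (Complex.nonneg_iff.1 (h 0)).1
    rw [h0] at h5 ⊢
    have hz : z = 0 := by simpa using h0
    have h6 : ∀ t : ℝ, 0 ≤ q * (t * t) + 0 * t + p := by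
      intro t
      have h4 := (Complex.nonneg_iff.1 (h t)).1
      rw [key, hz] at h4
      simp at h4
      nlinarith
    have := discrim_le_zero h6
    rw [discrim] at this
    nlinarith
  · have hpos : 0 < ‖z‖ ^ 2 := by positivity
    by_contra! hlt
    nlinarith

end Complex

section Factorization

variable {X E H : Type*} [AddCommGroup X] [Module ℂ X]
  [NormedAddCommGroup E] [InnerProductSpace ℂ E] [CompleteSpace E]
  [NormedAddCommGroup H] [InnerProductSpace ℂ H] [CompleteSpace H]

theorem LinearMap.exists_continuousLinearMap_comp_eq (T : X →ₗ[ℂ] E) (R : X →ₗ[ℂ] H)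
    (P : H →L[ℂ] H) (hP₀ : ∀ η, 0 ≤ (⟪η, P η⟫_ℂ).re)
    (hR : ∀ η x, ‖⟪η, R x⟫_ℂ‖ ^ 2 ≤ (⟪η, P η⟫_ℂ).re * ‖T x‖ ^ 2) :
    ∃ Y : E →L[ℂ] H, (∀ x, Y (T x) = R x) ∧
      ∀ η e, ‖⟪η, Y e⟫_ℂ‖ ^ 2 ≤ (⟪η, P η⟫_ℂ).re * ‖e‖ ^ 2 := by
  set M : Submodule ℂ E := (LinearMap.range T).topologicalClosure with hM
  have hTM : ∀ x, T x ∈ M := fun x => Submodule.le_topologicalClosure _ ⟨x, rfl⟩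
  let e : X →ₗ[ℂ] M := T.codRestrict M hTM
  have he : DenseRange e := by
    intro y
    rw [Topology.IsInducing.subtypeVal.closure_eq_preimage_closure_image]
    refine closure_mono ?_ y.2
    rintro _ ⟨x, rfl⟩
    exact ⟨e x, ⟨x, rfl⟩, rfl⟩
  have hP : ∀ η : H, (⟪η, P η⟫_ℂ).re ≤ ‖P‖ * ‖η‖ ^ 2 := by
    intro η
    calc (⟪η, P η⟫_ℂ).re ≤ ‖⟪η, P η⟫_ℂ‖ := Complex.re_le_norm _
      _ ≤ ‖η‖ * ‖P η‖ := norm_inner_le_norm _ _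
      _ ≤ ‖η‖ * (‖P‖ * ‖η‖) := by gcongr; exact P.le_opNorm η
      _ = _ := by ring
  have hb : ∀ x, ‖R x‖ ≤ √‖P‖ * ‖e x‖ := by
    intro x
    have h1 := hR (R x) x
    rw [inner_self_eq_norm_sq_to_K] at h1
    have h2 : ‖R x‖ ^ 2 * ‖R x‖ ^ 2 ≤ ‖R x‖ ^ 2 * (‖P‖ * ‖T x‖ ^ 2) := by
      calc ‖R x‖ ^ 2 * ‖R x‖ ^ 2 ≤ (⟪R x, P (R x)⟫_ℂ).re * ‖T x‖ ^ 2 := by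
            convert h1 using 1; simp; ring
        _ ≤ (‖P‖ * ‖R x‖ ^ 2) * ‖T x‖ ^ 2 := by gcongr; exact hP _
        _ = _ := by ring
    have hex : ‖e x‖ = ‖T x‖ := rfl
    rw [hex]
    rcases eq_or_ne ‖R x‖ 0 with h0 | h0
    · rw [h0]; positivity
    · have h3 := le_of_mul_le_mul_left h2 (by positivity)
      apply le_of_sq_le_sq ?_ (by positivity)
      rwa [mul_pow, Real.sq_sqrt (norm_nonneg _)]
  set Y₀ : M →L[ℂ] H := R.extendOfNorm e with hY₀
  have hY₀e : ∀ x, Y₀ (e x) = R x := LinearMap.extendOfNorm_eq he ⟨_, hb⟩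
  have hY₀b : ∀ η y, ‖⟪η, Y₀ y⟫_ℂ‖ ^ 2 ≤ (⟪η, P η⟫_ℂ).re * ‖y‖ ^ 2 := by
    intro η
    refine he.induction (P := fun y => ‖⟪η, Y₀ y⟫_ℂ‖ ^ 2 ≤ (⟪η, P η⟫_ℂ).re * ‖y‖ ^ 2) ?_
      (isClosed_le (by fun_prop) (by fun_prop))
    rintro _ ⟨x, rfl⟩
    rw [hY₀e]
    exact hR η x
  have : CompleteSpace M := (Submodule.isClosed_topologicalClosure _).completeSpace_coe
  refine ⟨Y₀ ∘L M.orthogonalProjectionOnto, fun x => ?_, fun η y => ?_⟩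
  · have : M.orthogonalProjectionOnto (T x) = e x :=
      Submodule.orthogonalProjectionOnto_mem_subspace_eq_self (e x)
    simp [this, hY₀e]
  · refine (hY₀b η _).trans ?_
    have := hP₀ η
    gcongr
    exact M.norm_orthogonalProjectionOnto_apply_le y

theorem ContinuousLinearMap.exists_adjoint_comp_self_eq_sub (Y : E →L[ℂ] H) (P : H →L[ℂ] H)
    (hP : ∀ η, 0 ≤ ⟪η, P η⟫_ℂ)
    (hY : ∀ η e, ‖⟪η, Y e⟫_ℂ‖ ^ 2 ≤ (⟪η, P η⟫_ℂ).re * ‖e‖ ^ 2) :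
    ∃ D : H →L[ℂ] H, ∀ ξ η,
      ⟪adjoint Y ξ, adjoint Y η⟫_ℂ + ⟪D ξ, D η⟫_ℂ = ⟪ξ, P η⟫_ℂ := by
  have hpos : 0 ≤ P - Y ∘L adjoint Y := by
    rw [ContinuousLinearMap.nonneg_iff_isPositive, ContinuousLinearMap.isPositive_iff_complex]
    intro η
    have h1 := hY η (adjoint Y η)
    have h2 : ⟪η, Y (adjoint Y η)⟫_ℂ = ((‖adjoint Y η‖ ^ 2 : ℝ) : ℂ) := by
      rw [← adjoint_inner_left, inner_self_eq_norm_sq_to_K]; simp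
    have h3 := Complex.nonneg_iff.1 (hP η)
    rw [h2] at h1
    have h4 : ‖adjoint Y η‖ ^ 2 ≤ (⟪η, P η⟫_ℂ).re := by
      rcases eq_or_ne (‖adjoint Y η‖) 0 with h0 | h0
      · rw [h0]; simpa using h3.1
      · have : 0 < ‖adjoint Y η‖ ^ 2 := by positivity
        rw [Complex.norm_real, Real.norm_of_nonneg this.le] at h1
        nlinarith
    have h5 : ⟪η, (P - Y ∘L adjoint Y) η⟫_ℂ
        = (((⟪η, P η⟫_ℂ).re - ‖adjoint Y η‖ ^ 2 : ℝ) : ℂ) := by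
      rw [sub_apply, inner_sub_right, comp_apply, h2]
      apply Complex.ext <;> simp [← h3.2]
    rw [← inner_conj_symm, h5]
    simp only [Complex.conj_ofReal]
    exact ⟨by simp only [RCLike.re_to_complex, Complex.ofReal_re],
      by rw [RCLike.re_to_complex, Complex.ofReal_re]; linarith⟩
  obtain ⟨D, hD⟩ := CStarAlgebra.nonneg_iff_eq_star_mul_self.1 hpos
  refine ⟨D, fun ξ η => ?_⟩
  have h6 : ⟪ξ, (P - Y ∘L adjoint Y) η⟫_ℂ = ⟪D ξ, D η⟫_ℂ := by
    rw [hD, star_eq_adjoint]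
    exact adjoint_inner_right D ξ (D η)
  rw [← h6, sub_apply, inner_sub_right, comp_apply, ← adjoint_inner_left Y]
  ring

end Factorization

section Completion

variable {G : Type*} [AddCommGroup G]

namespace IsAddPosDefFnOn

variable {H : Type*} [NormedAddCommGroup H] [InnerProductSpace ℂ H] {S : Set G}
  {φ : G → H →L[ℂ] H}

theorem sum_finset_nonneg (hφ : IsAddPosDefFnOn S φ) (B : Finset G)
    (hB : ∀ g ∈ B, ∀ h ∈ B, h - g ∈ S) (ξ : G → H) :
    0 ≤ ∑ g ∈ B, ∑ h ∈ B, ⟪ξ g, φ (h - g) (ξ h)⟫_ℂ := by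
  have h1 := hφ B.card (fun i => (B.equivFin.symm i : G))
    (fun i j => hB _ (B.equivFin.symm i).2 _ (B.equivFin.symm j).2)
    (fun i => ξ (B.equivFin.symm i))
  rw [Equiv.sum_comp B.equivFin.symm (fun g : B => ∑ j : Fin B.card,
    ⟪ξ g, φ ((B.equivFin.symm j : G) - g) (ξ (B.equivFin.symm j))⟫_ℂ)] at h1
  rw [← Finset.sum_coe_sort B]
  convert h1 using 2 with g
  rw [Equiv.sum_comp B.equivFin.symm (fun h : B => ⟪ξ g, φ ((h : G) - g) (ξ h)⟫_ℂ),
    ← Finset.sum_coe_sort B]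

theorem inner_zero_nonneg (hφ : IsAddPosDefFnOn S φ) (h0 : (0 : G) ∈ S) (ξ : H) :
    0 ≤ ⟪ξ, φ 0 ξ⟫_ℂ := by
  simpa using hφ.sum_finset_nonneg {0} (by simpa using h0) (fun _ => ξ)

theorem ofReal_re_inner_zero (hφ : IsAddPosDefFnOn S φ) (h0 : (0 : G) ∈ S) (ξ : H) :
    ((⟪ξ, φ 0 ξ⟫_ℂ).re : ℂ) = ⟪ξ, φ 0 ξ⟫_ℂ := by
  have := (Complex.nonneg_iff.1 (hφ.inner_zero_nonneg h0 ξ)).2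
  apply Complex.ext <;> simp [← this]

theorem inner_eq_conj (hφ : IsAddPosDefFnOn S φ) (h0 : (0 : G) ∈ S)
    (hS : ∀ s ∈ S, -s ∈ S) {s : G} (hs : s ∈ S) (ξ η : H) :
    ⟪ξ, φ s η⟫_ℂ = conj ⟪η, φ (-s) ξ⟫_ℂ := by
  refine (Complex.eq_conj_and_sq_norm_le_of_forall_nonneg (p := (⟪ξ, φ 0 ξ⟫_ℂ).re)
    (q := (⟪η, φ 0 η⟫_ℂ).re) fun c => ?_).1
  have h1 := hφ 2 ![0, s] (by
    intro i j
    fin_cases i <;> fin_cases j <;> simp [h0, hs, hS s hs]) ![ξ, c • η]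
  simp only [Fin.sum_univ_two, Matrix.cons_val_zero, Matrix.cons_val_one, sub_self, sub_zero,
    zero_sub, neg_zero, map_smul, inner_smul_left, inner_smul_right] at h1
  rw [hφ.ofReal_re_inner_zero h0, hφ.ofReal_re_inner_zero h0]
  convert h1 using 1
  ring

/-- Cauchy-Schwarz inequality for the positive form attached to a clique `B` together with one
further vertex `n`, in a factorization `V` of `φ` over `B`. -/
theorem sq_norm_inner_sum_le (hφ : IsAddPosDefFnOn S φ) (h0 : (0 : G) ∈ S)
    (hS : ∀ s ∈ S, -s ∈ S) {E : Type*} [NormedAddCommGroup E] [InnerProductSpace ℂ E]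
    (V : G → H →L[ℂ] E) (B : Finset G) (n : G) (hn : n ∉ B)
    (hB : ∀ g ∈ B, ∀ h ∈ B, h - g ∈ S) (hnB : ∀ g ∈ B, n - g ∈ S)
    (hV : ∀ g ∈ B, ∀ h ∈ B, ∀ ξ η, ⟪V g ξ, V h η⟫_ℂ = ⟪ξ, φ (h - g) η⟫_ℂ)
    (η : H) (ξ : G → H) :
    ‖⟪η, ∑ g ∈ B, φ (g - n) (ξ g)⟫_ℂ‖ ^ 2 ≤
      (⟪η, φ 0 η⟫_ℂ).re * ‖∑ g ∈ B, V g (ξ g)‖ ^ 2 := by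
  classical
  rw [mul_comm]
  refine (Complex.eq_conj_and_sq_norm_le_of_forall_nonneg
    (w := ∑ g ∈ B, ⟪ξ g, φ (n - g) η⟫_ℂ) fun c => ?_).2
  have hgn : ∀ g ∈ B, g - n ∈ S := fun g hg => by simpa using hS _ (hnB g hg)
  have h1 := hφ.sum_finset_nonneg (insert n B) (by
    intro g hg h hh
    rcases Finset.mem_insert.1 hg with hgn' | hg <;> rcases Finset.mem_insert.1 hh with hhn' | hh
    · simpa [hgn', hhn'] using h0
    · exact hgn' ▸ hgn h hh
    · exact hhn' ▸ hnB g hg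
    · exact hB g hg h hh) (Function.update ξ n (c • η))
  have h2 : ∀ g ∈ B, Function.update ξ n (c • η) g = ξ g := fun g hg =>
    Function.update_of_ne (by rintro rfl; exact hn hg) _ _
  have hrow : ∑ h ∈ B, ⟪c • η, φ (h - n) (Function.update ξ n (c • η) h)⟫_ℂ =
      conj c * ⟪η, ∑ g ∈ B, φ (g - n) (ξ g)⟫_ℂ := by
    rw [inner_sum, Finset.mul_sum]
    exact Finset.sum_congr rfl fun g hg => by rw [h2 g hg, inner_smul_left]
  have hcol : ∑ g ∈ B, ⟪Function.update ξ n (c • η) g, φ (n - g) (c • η)⟫_ℂ =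
      c * ∑ g ∈ B, ⟪ξ g, φ (n - g) η⟫_ℂ := by
    rw [Finset.mul_sum]
    exact Finset.sum_congr rfl fun g hg => by rw [h2 g hg, map_smul, inner_smul_right]
  have hblock : ∑ g ∈ B, ∑ h ∈ B, ⟪Function.update ξ n (c • η) g,
      φ (h - g) (Function.update ξ n (c • η) h)⟫_ℂ =
      ((‖∑ g ∈ B, V g (ξ g)‖ ^ 2 : ℝ) : ℂ) := by
    have h3 := inner_self_eq_norm_sq_to_K (𝕜 := ℂ) (∑ g ∈ B, V g (ξ g))
    push_cast
    rw [RCLike.ofReal_eq_complex_ofReal] at h3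
    rw [← h3, sum_inner]
    refine Finset.sum_congr rfl fun g hg => ?_
    rw [inner_sum]
    exact Finset.sum_congr rfl fun h hh => by rw [h2 g hg, h2 h hh, hV g hg h hh]
  simp only [Finset.sum_insert hn, Finset.sum_add_distrib, Function.update_self, hrow, hcol,
    hblock, sub_self] at h1
  rw [map_smul, inner_smul_left, inner_smul_right] at h1
  rw [hφ.ofReal_re_inner_zero h0]
  convert h1 using 1
  ring

end IsAddPosDefFnOn

universe u

/-- A positive definite function on a strip admits, over every finite vertex set, a Kolmogorov
factorization realizing its values on the edges of the (chordal) strip graph. -/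
theorem IsAddPosDefFnOn.exists_factorization {H : Type u} [NormedAddCommGroup H]
    [InnerProductSpace ℂ H] [CompleteSpace H] (L : G →+ ℝ) {a : ℝ} (ha : 0 < a)
    {φ : G → H →L[ℂ] H} (hφ : IsAddPosDefFnOn {g | |L g| < a} φ) (F : Finset G) :
    ∃ (E : Type u) (_ : NormedAddCommGroup E) (_ : InnerProductSpace ℂ E) (_ : CompleteSpace E)
      (V : G → H →L[ℂ] E), ∀ g ∈ F, ∀ h ∈ F, |L (h - g)| < a →
        ∀ ξ η, ⟪V g ξ, V h η⟫_ℂ = ⟪ξ, φ (h - g) η⟫_ℂ := by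
  classical
  have h0 : (0 : G) ∈ {g | |L g| < a} := by simpa using ha
  have hS : ∀ s ∈ {g | |L g| < a}, -s ∈ {g | |L g| < a} := fun s hs => by simpa using hs
  induction F using Finset.induction_on_max_value L with
  | empty => exact ⟨H, inferInstance, inferInstance, inferInstance, fun _ => 0, by simp⟩
  | insert n s hns hmax ih =>
    obtain ⟨E, _, _, _, V, hV⟩ := ih
    set B := s.filter (fun g => |L (n - g)| < a) with hBdef
    have hBs : ∀ g ∈ B, g ∈ s := fun g hg => (Finset.mem_filter.1 hg).1
    have hnB : ∀ g ∈ B, |L (n - g)| < a := fun g hg => (Finset.mem_filter.1 hg).2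
    have hB : ∀ g ∈ B, ∀ h ∈ B, |L (h - g)| < a := by
      intro g hg h hh
      have h1 := hnB g hg
      have h2 := hnB h hh
      have h3 := hmax g (hBs g hg)
      have h4 := hmax h (hBs h hh)
      rw [map_sub, abs_lt] at *
      constructor <;> linarith
    have hVB : ∀ g ∈ B, ∀ h ∈ B, ∀ ξ η, ⟪V g ξ, V h η⟫_ℂ = ⟪ξ, φ (h - g) η⟫_ℂ :=
      fun g hg h hh => hV g (hBs g hg) h (hBs h hh) (hB g hg h hh)
    have hpos := hφ.inner_zero_nonneg h0
    obtain ⟨Y, hYT, hY⟩ := LinearMap.exists_continuousLinearMap_comp_eq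
      (∑ g ∈ B, (V g).toLinearMap ∘ₗ LinearMap.proj (R := ℂ) (φ := fun _ : G => H) g)
      (∑ g ∈ B, (φ (g - n)).toLinearMap ∘ₗ LinearMap.proj (R := ℂ) (φ := fun _ : G => H) g)
      (φ 0) (fun η => (Complex.nonneg_iff.1 (hpos η)).1) (fun η ξ => by
        simpa using hφ.sq_norm_inner_sum_le h0 hS V B n (fun h => hns (hBs n h)) hB hnB hVB η ξ)
    have hYV : ∀ g ∈ B, ∀ ξ, Y (V g ξ) = φ (g - n) ξ := by
      intro g hg ξ
      have key : ∀ {F : Type u} [NormedAddCommGroup F] [NormedSpace ℂ F] (A : G → H →L[ℂ] F),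
          (∑ k ∈ B, (A k).toLinearMap ∘ₗ LinearMap.proj (R := ℂ) (φ := fun _ : G => H) k)
            (Pi.single g ξ) = A g ξ := by
        intro F _ _ A
        rw [LinearMap.sum_apply, Finset.sum_eq_single_of_mem g hg]
        · simp
        · intro k _ hk
          simp [Pi.single_eq_of_ne hk]
      have := hYT (Pi.single g ξ)
      rwa [key V, key (fun k => φ (k - n))] at this
    obtain ⟨D, hD⟩ := ContinuousLinearMap.exists_adjoint_comp_self_eq_sub Y (φ 0) hpos hY
    let J : (E × H) →L[ℂ] WithLp 2 (E × H) :=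
      (WithLp.prodContinuousLinearEquiv 2 ℂ E H).symm.toContinuousLinearMap
    have hJ : ∀ x y, ⟪J x, J y⟫_ℂ = ⟪x.1, y.1⟫_ℂ + ⟪x.2, y.2⟫_ℂ := fun x y => rfl
    refine ⟨WithLp 2 (E × H), inferInstance, inferInstance, inferInstance,
      fun g => if g = n then J ∘L ((ContinuousLinearMap.adjoint Y).prod D)
        else J ∘L ((V g).prod 0), ?_⟩
    intro g hg h hh hgh ξ η
    rcases Finset.mem_insert.1 hg with rfl | hgs <;>
      rcases Finset.mem_insert.1 hh with rfl | hhs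
    · simp [hJ, hD]
    · have hne : h ≠ g := by rintro rfl; exact hns hhs
      have hhB : h ∈ B := Finset.mem_filter.2 ⟨hhs, by rwa [← neg_sub, map_neg, abs_neg]⟩
      simp [hJ, hne, ContinuousLinearMap.adjoint_inner_left, hYV h hhB]
    · have hne : g ≠ h := by rintro rfl; exact hns hgs
      have hgB : g ∈ B := Finset.mem_filter.2 ⟨hgs, hgh⟩
      rw [hφ.inner_eq_conj h0 hS hgh]
      simp [hJ, hne, ContinuousLinearMap.adjoint_inner_right, hYV g hgB]
    · have hne : g ≠ n := by rintro rfl; exact hns hgs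
      have hne' : h ≠ n := by rintro rfl; exact hns hhs
      simp [hJ, hne, hne', hV g hgs h hhs hgh]

end Completion

section Averaging

variable {G : Type*} [AddCommGroup G]

theorem isAddPosDefFn_sum_adjoint_comp {H E : Type*} [NormedAddCommGroup H]
    [InnerProductSpace ℂ H] [CompleteSpace H] [NormedAddCommGroup E] [InnerProductSpace ℂ E]
    [CompleteSpace E] (F : Finset G) (V : G → H →L[ℂ] E) (hV : ∀ t ∉ F, V t = 0) :
    IsAddPosDefFn fun s => ∑ t ∈ F, ContinuousLinearMap.adjoint (V t) ∘L V (t + s) := by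
  intro n g ξ
  have hsupp : ∀ i j,
      (Function.support fun u => ⟪V (u + g i) (ξ i), V (u + g j) (ξ j)⟫_ℂ).Finite := by
    intro i j
    refine (F.finite_toSet.preimage (add_left_injective (g i)).injOn).subset fun u hu => ?_
    by_contra hF
    exact hu (by simp [hV (u + g i) (by simpa using hF)])
  have hterm : ∀ i j, ⟪ξ i, (∑ t ∈ F, ContinuousLinearMap.adjoint (V t) ∘L V (t + (g j - g i)))
      (ξ j)⟫_ℂ = ∑ᶠ u, ⟪V (u + g i) (ξ i), V (u + g j) (ξ j)⟫_ℂ := by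
    intro i j
    rw [← finsum_comp_equiv (Equiv.subRight (g i))]
    rw [finsum_eq_sum_of_support_subset (s := F)]
    · have hshift : ∀ t, t - g i + g j = t + (g j - g i) := fun t => by abel
      simp [ContinuousLinearMap.adjoint_inner_right, hshift]
    · intro t ht
      by_contra hF
      exact ht (by simp [hV t (by simpa using hF)])
  simp only [hterm]
  rw [Finset.sum_congr rfl fun i _ => (finsum_sum_comm _ _ fun j _ => hsupp i j).symm,
    ← finsum_sum_comm]
  · refine finsum_nonneg fun u => ?_
    simp only [← inner_sum, ← sum_inner]
    rw [inner_self_eq_norm_sq_to_K, RCLike.ofReal_eq_complex_ofReal, ← Complex.ofReal_pow]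
    exact Complex.zero_le_real.2 (by positivity)
  · intro i _
    refine (Set.finite_iUnion fun j => hsupp i j).subset fun u hu => ?_
    obtain ⟨j, -, hj⟩ := Finset.exists_ne_zero_of_sum_ne_zero hu
    exact Set.mem_iUnion.2 ⟨j, hj⟩

theorem IsAddPosDefFn.smul {H : Type*} [NormedAddCommGroup H] [InnerProductSpace ℂ H]
    {Φ : G → H →L[ℂ] H} (hΦ : IsAddPosDefFn Φ) {c : ℂ} (hc : 0 ≤ c) :
    IsAddPosDefFn fun s => c • Φ s := by
  intro n g ξ
  simpa [inner_smul_right, Finset.mul_sum] using mul_nonneg hc (hΦ n g ξ)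

/-- Averaging a factorization over a finite set `F` produces a bounded positive definite function
which agrees with `φ` on the strip up to the proportion of `F` overlapping its translate. -/
theorem IsAddPosDefFnOn.exists_isAddPosDefFn_average [DecidableEq G] {H : Type u}
    [NormedAddCommGroup H] [InnerProductSpace ℂ H] [CompleteSpace H] (L : G →+ ℝ) {a : ℝ}
    (ha : 0 < a) {φ : G → H →L[ℂ] H} (hφ : IsAddPosDefFnOn {g | |L g| < a} φ) (F : Finset G) :
    ∃ Ψ : G → H →L[ℂ] H, IsAddPosDefFn Ψ ∧
      (∀ s ξ η, ‖⟪ξ, Ψ s η⟫_ℂ‖ ≤ ‖φ 0‖ * ‖ξ‖ * ‖η‖) ∧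
      ∀ s, |L s| < a →
        Ψ s = (((F.filter fun t => t + s ∈ F).card / F.card : ℝ) : ℂ) • φ s := by
  obtain ⟨E, _, _, _, V₀, hV₀⟩ := hφ.exists_factorization L ha F
  set V : G → H →L[ℂ] E := fun t => if t ∈ F then V₀ t else 0 with hVdef
  have hVmem : ∀ t ∈ F, V t = V₀ t := fun t ht => if_pos ht
  have hVnot : ∀ t ∉ F, V t = 0 := fun t ht => if_neg ht
  have hnorm : ∀ t ξ, ‖V t ξ‖ ≤ √‖φ 0‖ * ‖ξ‖ := by
    intro t ξ
    by_cases ht : t ∈ F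
    · apply le_of_sq_le_sq _ (by positivity)
      have h1 := hV₀ t ht t ht (by simpa using ha) ξ ξ
      rw [inner_self_eq_norm_sq_to_K, sub_self] at h1
      rw [hVmem t ht, mul_pow, Real.sq_sqrt (norm_nonneg _)]
      calc ‖V₀ t ξ‖ ^ 2 = ‖⟪ξ, φ 0 ξ⟫_ℂ‖ := by rw [← h1]; simp
        _ ≤ ‖ξ‖ * ‖φ 0 ξ‖ := norm_inner_le_norm _ _
        _ ≤ ‖ξ‖ * (‖φ 0‖ * ‖ξ‖) := by gcongr; exact (φ 0).le_opNorm ξ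
        _ = _ := by ring
    · simp only [hVnot t ht, zero_apply, norm_zero]
      positivity
  refine ⟨fun s => (((F.card : ℝ)⁻¹ : ℝ) : ℂ) •
    ∑ t ∈ F, ContinuousLinearMap.adjoint (V t) ∘L V (t + s),
    (isAddPosDefFn_sum_adjoint_comp F V hVnot).smul (Complex.zero_le_real.2 (by positivity)),
    fun s ξ η => ?_, fun s hs => ?_⟩
  · rw [smul_apply, inner_smul_right, norm_mul, Complex.norm_real,
      Real.norm_of_nonneg (by positivity), sum_apply, inner_sum]
    have hsum : ‖∑ t ∈ F, ⟪ξ, (ContinuousLinearMap.adjoint (V t) ∘L V (t + s)) η⟫_ℂ‖ ≤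
        F.card * (‖φ 0‖ * ‖ξ‖ * ‖η‖) := by
      rw [← nsmul_eq_mul]
      refine norm_sum_le_of_le F (fun t _ => ?_) |>.trans (Finset.sum_const _).le
      rw [ContinuousLinearMap.comp_apply, ContinuousLinearMap.adjoint_inner_right]
      calc _ ≤ ‖V t ξ‖ * ‖V (t + s) η‖ := norm_inner_le_norm _ _
        _ ≤ (√‖φ 0‖ * ‖ξ‖) * (√‖φ 0‖ * ‖η‖) := by gcongr <;> exact hnorm _ _
        _ = (√‖φ 0‖ * √‖φ 0‖) * ‖ξ‖ * ‖η‖ := by ring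
        _ = _ := by rw [Real.mul_self_sqrt (norm_nonneg _)]
    rcases Nat.eq_zero_or_pos F.card with h | h
    · rw [h]; simp; positivity
    · have h' : (0 : ℝ) < F.card := by exact_mod_cast h
      rw [inv_mul_le_iff₀ h']
      exact hsum
  · have hterm : ∀ t ∈ F, ContinuousLinearMap.adjoint (V t) ∘L V (t + s) =
        if t + s ∈ F then φ s else 0 := by
      intro t ht
      split_ifs with hts
      · ext η
        refine ext_inner_left ℂ fun ξ => ?_
        rw [ContinuousLinearMap.comp_apply, ContinuousLinearMap.adjoint_inner_right,
          hVmem t ht, hVmem _ hts, hV₀ t ht _ hts (by simpa using hs), add_sub_cancel_left]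
      · simp [hVnot _ hts]
    simp only
    rw [Finset.sum_congr rfl hterm, ← Finset.sum_filter, Finset.sum_const,
      ← Nat.cast_smul_eq_nsmul ℂ, smul_smul]
    push_cast
    rw [div_eq_inv_mul]

end Averaging

section Limit

theorem ContinuousLinearMap.exists_tendsto_inner_ultrafilter {ι H : Type*} [NormedAddCommGroup H]
    [InnerProductSpace ℂ H] [CompleteSpace H] (U : Ultrafilter ι) (T : ι → H →L[ℂ] H) (C : ℝ)
    (hT : ∀ i ξ η, ‖⟪ξ, T i η⟫_ℂ‖ ≤ C * ‖ξ‖ * ‖η‖) :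
    ∃ T₀ : H →L[ℂ] H, ∀ ξ η, Tendsto (fun i => ⟪ξ, T i η⟫_ℂ) U (𝓝 ⟪ξ, T₀ η⟫_ℂ) := by
  have hex : ∀ ξ η, ∃ z : ℂ, ‖z‖ ≤ C * ‖ξ‖ * ‖η‖ ∧
      Tendsto (fun i => ⟪ξ, T i η⟫_ℂ) U (𝓝 z) := by
    intro ξ η
    obtain ⟨z, hz, hlim⟩ := (isCompact_closedBall (0 : ℂ) (C * ‖ξ‖ * ‖η‖)).ultrafilter_le_nhds
      (U.map fun i => ⟪ξ, T i η⟫_ℂ) (by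
        rw [le_principal_iff]
        exact Filter.mem_map.2 (Filter.univ_mem' fun i => by simpa using hT i ξ η))
    exact ⟨z, by simpa using hz, hlim⟩
  choose b hb hlim using hex
  let B : H →ₗ⋆[ℂ] H →ₗ[ℂ] ℂ := LinearMap.mk₂'ₛₗ (starRingEnd ℂ) (RingHom.id ℂ) b
    (fun x y z => tendsto_nhds_unique (hlim _ _)
      (((hlim x z).add (hlim y z)).congr fun i => (inner_add_left _ _ _).symm))
    (fun c x y => tendsto_nhds_unique (hlim _ _)
      (((hlim x y).const_mul (conj c)).congr fun i => (inner_smul_left _ _ _).symm))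
    (fun x y z => tendsto_nhds_unique (hlim _ _)
      (((hlim x y).add (hlim x z)).congr fun i => by rw [map_add, inner_add_right]))
    (fun c x y => tendsto_nhds_unique (hlim _ _)
      (((hlim x y).const_mul c).congr fun i => by rw [map_smul, inner_smul_right]))
  let B' : H →L⋆[ℂ] H →L[ℂ] ℂ := B.mkContinuous₂ C hb
  refine ⟨adjoint (InnerProductSpace.continuousLinearMapOfBilin B'), fun ξ η => ?_⟩
  rw [adjoint_inner_right, InnerProductSpace.continuousLinearMapOfBilin_apply]
  exact hlim ξ η

theorem isAddPosDefFn_of_tendsto {G ι H : Type*} [AddGroup G] [NormedAddCommGroup H]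
    [InnerProductSpace ℂ H] {l : Filter ι} [l.NeBot] {Ψ : ι → G → H →L[ℂ] H}
    {Φ : G → H →L[ℂ] H} (hΨ : ∀ i, IsAddPosDefFn (Ψ i))
    (hlim : ∀ s ξ η, Tendsto (fun i => ⟪ξ, Ψ i s η⟫_ℂ) l (𝓝 ⟪ξ, Φ s η⟫_ℂ)) :
    IsAddPosDefFn Φ := fun n g ξ =>
  ge_of_tendsto' (tendsto_finsetSum _ fun i _ => tendsto_finsetSum _ fun j _ => hlim _ _ _)
    fun i => hΨ i n g ξ

end Limit

section Box

theorem Int.card_filter_add_mem_Ico (N : ℕ) (s : ℤ) (hs : |s| ≤ N) :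
    (((Finset.Ico (0 : ℤ) N).filter fun t => t + s ∈ Finset.Ico (0 : ℤ) N).card : ℝ) =
      N - |(s : ℝ)| := by
  have : (Finset.Ico (0 : ℤ) N).filter (fun t => t + s ∈ Finset.Ico (0 : ℤ) N) =
      Finset.Ico (max 0 (-s)) (min (N : ℤ) (N - s)) := by
    ext t
    simp only [Finset.mem_filter, Finset.mem_Ico]
    omega
  rw [this, Int.card_Ico]
  have h : ((min (N : ℤ) (N - s) - max 0 (-s)).toNat : ℤ) = N - |s| := by
    rcases abs_cases s with ⟨h, _⟩ | ⟨h, _⟩ <;> omega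
  exact_mod_cast congrArg (Int.cast : ℤ → ℝ) h

theorem tendsto_card_filter_add_mem_box_div (s : ℤ × ℤ) :
    Tendsto (fun N : ℕ => ((((Finset.Ico (0 : ℤ) N ×ˢ Finset.Ico (0 : ℤ) N).filter
        fun t => t + s ∈ Finset.Ico (0 : ℤ) N ×ˢ Finset.Ico (0 : ℤ) N).card : ℝ) /
      (Finset.Ico (0 : ℤ) N ×ˢ Finset.Ico (0 : ℤ) N).card)) atTop (𝓝 1) := by
  have hlim : ∀ c : ℝ, Tendsto (fun N : ℕ => 1 - c / (N : ℝ)) atTop (𝓝 1) := fun c => by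
    simpa using (tendsto_const_div_atTop_nhds_zero_nat c).const_sub 1
  have h1 := (hlim |(s.1 : ℝ)|).mul (hlim |(s.2 : ℝ)|)
  rw [one_mul] at h1
  refine h1.congr' ?_
  filter_upwards [eventually_ge_atTop (s.1.natAbs + s.2.natAbs + 1)] with N hN
  have hprod : (Finset.Ico (0 : ℤ) N ×ˢ Finset.Ico (0 : ℤ) N).filter
      (fun t => t + s ∈ Finset.Ico (0 : ℤ) N ×ˢ Finset.Ico (0 : ℤ) N) =
      ((Finset.Ico (0 : ℤ) N).filter fun t => t + s.1 ∈ Finset.Ico (0 : ℤ) N) ×ˢ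
        ((Finset.Ico (0 : ℤ) N).filter fun t => t + s.2 ∈ Finset.Ico (0 : ℤ) N) := by
    ext t
    simp only [Finset.mem_filter, Finset.mem_product, Prod.fst_add, Prod.snd_add]
    tauto
  have hN0 : (N : ℝ) ≠ 0 := by
    have : N ≠ 0 := by omega
    exact_mod_cast this
  rw [hprod, Finset.card_product, Finset.card_product, Nat.cast_mul,
    Int.card_filter_add_mem_Ico N s.1 (by rw [Int.abs_eq_natAbs]; omega),
    Int.card_filter_add_mem_Ico N s.2 (by rw [Int.abs_eq_natAbs]; omega)]
  simp only [Int.card_Ico, sub_zero, Int.toNat_natCast]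
  push_cast
  field_simp

end Box

/-- For `α, β ∈ ℝ`, `a > 0`, and the strip `S = {(m,n) : |αm + βn| < a} ⊆ ℤ²`, every positive
definite operator function on `S` extends to a positive definite function on `ℤ²`. -/
theorem strip_extension
    {H : Type*} [NormedAddCommGroup H] [InnerProductSpace ℂ H] [CompleteSpace H]
    (α β a : ℝ) (ha : 0 < a)
    (φ : ℤ × ℤ → H →L[ℂ] H)
    (hφ : IsAddPosDefFnOn {p : ℤ × ℤ | |α * (p.1 : ℝ) + β * (p.2 : ℝ)| < a} φ) :
    ∃ Φ : ℤ × ℤ → H →L[ℂ] H, IsAddPosDefFn Φ ∧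
      ∀ s ∈ {p : ℤ × ℤ | |α * (p.1 : ℝ) + β * (p.2 : ℝ)| < a}, Φ s = φ s := by
  let L : ℤ × ℤ →+ ℝ := AddMonoidHom.mk' (fun p => α * (p.1 : ℝ) + β * (p.2 : ℝ))
    (fun p q => by simp only [Prod.fst_add, Prod.snd_add]; push_cast; ring)
  have hL : IsAddPosDefFnOn {p | |L p| < a} φ := hφ
  choose Ψ hΨ hbound hagree using fun N : ℕ =>
    hL.exists_isAddPosDefFn_average L ha (Finset.Ico (0 : ℤ) N ×ˢ Finset.Ico (0 : ℤ) N)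
  choose Φ hΦ using fun s => ContinuousLinearMap.exists_tendsto_inner_ultrafilter
    (hyperfilter ℕ) (fun N => Ψ N s) ‖φ 0‖ (fun N => hbound N s)
  refine ⟨Φ, isAddPosDefFn_of_tendsto hΨ hΦ, fun s hs => ?_⟩
  ext η
  refine ext_inner_left ℂ fun ξ => tendsto_nhds_unique (hΦ s ξ η) ?_
  have h1 := ((Complex.continuous_ofReal.tendsto 1).comp
    (tendsto_card_filter_add_mem_box_div s)).mul_const ⟪ξ, φ s η⟫_ℂ
  rw [Complex.ofReal_one, one_mul] at h1
  refine (h1.mono_left Nat.hyperfilter_le_atTop).congr fun N => ?_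
  rw [hagree N s hs, smul_apply, inner_smul_right]
  rfl
end
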